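/- arXiv:1910.13378 — 3 statements merged into one kernel-verified Lean document; each statement's English description precedes it below -/
import Mathlib

section
/- For every partition λ and variables x = (x_1,…,x_n), the dual symmetric Grothendieck polynomial satisfies the Jacobi–Trudi identity g_λ(x) = det[ e_{λ'_i − i + j}(1^{λ'_i − 1}, x) ]_{1 ≤ i,j ≤ λ_1}, where λ' is the conjugate partition, e_m denotes the elementary symmetric polynomial (with e_m = 0 for m < 0), and e_m(1^k, x) means e_m in k + n variables with the first k variables specialized to 1. -/
open scoped BigOperators

/-- A plane partition: a matrix of naturals (0-indexed) with weakly decreasing rows and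
columns and finitely many nonzero entries. -/
structure PlanePartition where
  entry : ℕ → ℕ → ℕ
  row_decr : ∀ i j, entry i (j + 1) ≤ entry i j
  col_decr : ∀ i j, entry (i + 1) j ≤ entry i j
  finite_support : {p : ℕ × ℕ | entry p.1 p.2 ≠ 0}.Finite

namespace PlanePartition

/-- `π` has at most `b` (nonzero) rows. -/
def rowsLE (π : PlanePartition) (b : ℕ) : Prop := ∀ i j, b ≤ i → π.entry i j = 0

/-- `π` has at most `a` (nonzero) columns. -/
def colsLE (π : PlanePartition) (a : ℕ) : Prop := ∀ i j, a ≤ j → π.entry i j = 0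

/-- all entries of `π` are at most `c`. -/
def entriesLE (π : PlanePartition) (c : ℕ) : Prop := ∀ i j, π.entry i j ≤ c

/-- the number of columns of `π` containing the entry `ℓ`. -/
noncomputable def cCol (π : PlanePartition) (ℓ : ℕ) : ℕ :=
  {j | ∃ i, π.entry i j = ℓ}.ncard

/-- the length of the `i`-th row of `π` (0-indexed); this is the `(i+1)`-st part of
the shape of `π`. -/
noncomputable def rowLen (π : PlanePartition) (i : ℕ) : ℕ :=
  {j | 0 < π.entry i j}.ncard

/-- `d_{iℓ} = #{j : π_{ij} = ℓ > π_{i+1,j}}`; the row index `i` is 0-indexed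
while `ℓ` denotes the actual value. -/
noncomputable def phi (π : PlanePartition) (i ℓ : ℕ) : ℕ :=
  {j | π.entry i j = ℓ ∧ π.entry (i + 1) j < ℓ}.ncard

/-- `Φ(π)` as a 0-indexed matrix: entry `(i, l)` counts `j` with `π_{ij} = l+1 > π_{i+1,j}`. -/
noncomputable def phiMatrix (π : PlanePartition) : ℕ → ℕ → ℕ :=
  fun i l => π.phi i (l + 1)

/-- `π` has shape `μ`. -/
def hasShape (π : PlanePartition) (μ : YoungDiagram) : Prop :=
  ∀ i j, 0 < π.entry i j ↔ (i, j) ∈ μ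

/-- the descent set of `π` (0-indexed positions). -/
def des (π : PlanePartition) : Set (ℕ × ℕ) :=
  {p | π.entry (p.1 + 1) p.2 < π.entry p.1 p.2}

end PlanePartition

/-- the set of plane partitions with at most `a` columns, at most `b` rows
and entries at most `c`. -/
def PP (a b c : ℕ) : Set PlanePartition :=
  {π | π.colsLE a ∧ π.rowsLE b ∧ π.entriesLE c}

/-- `PP(∞, b, c)`: plane partitions with at most `b` rows and entries at most `c`. -/
def PPinf (b c : ℕ) : Set PlanePartition :=
  {π | π.rowsLE b ∧ π.entriesLE c}

/-- a monotone lattice path (as a list of points) from `s` to `t`. -/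
def IsMonPath (L : List (ℕ × ℕ)) (s t : ℕ × ℕ) : Prop :=
  L.head? = some s ∧ L.getLast? = some t ∧
    L.Chain' fun p q => q = (p.1 + 1, p.2) ∨ q = (p.1, p.2 + 1)

/-- the last passage time: the maximal weight of a monotone path from `s` to `t`
in the matrix `d`. -/
noncomputable def lastPassage (d : ℕ → ℕ → ℕ) (s t : ℕ × ℕ) : ℕ :=
  sSup {n | ∃ L, IsMonPath L s t ∧ n = (L.map fun p => d p.1 p.2).sum}

/-- `b×c` matrices of naturals (as functions vanishing off `[0,b) × [0,c)`) whose
last passage time `G(b,c)` is at most `a`. -/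
def BM (a b c : ℕ) : Set (ℕ → ℕ → ℕ) :=
  {d | (∀ i j, b ≤ i → d i j = 0) ∧ (∀ i j, c ≤ j → d i j = 0) ∧
    lastPassage d (0, 0) (b - 1, c - 1) ≤ a}

/-- the rectangular Young diagram of the partition `(a^b)` (with `b` rows of length `a`). -/
def rectDiagram (a b : ℕ) : YoungDiagram where
  cells := Finset.range b ×ˢ Finset.range a
  isLowerSet := by
    intro p q hle hp
    simp only [Finset.coe_product, Set.mem_prod, Finset.mem_coe, Finset.mem_range] at hp ⊢
    exact ⟨lt_of_le_of_lt hle.1 hp.1, lt_of_le_of_lt hle.2 hp.2⟩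

/-- the variables `(1^b, x_1, x_2, …)`: the first `b` variables are specialized to `1`. -/
def oneExtend (b : ℕ) (x : ℕ → ℝ) : ℕ → ℝ :=
  fun i => if i < b then 1 else x (i - b)

/-- the Schur polynomial `s_μ(x_1, …, x_N)` evaluated at real arguments;
variables are 0-indexed (`x ℓ` is the variable `x_{ℓ+1}`), as are tableau entries. -/
noncomputable def schur (μ : YoungDiagram) (N : ℕ) (x : ℕ → ℝ) : ℝ :=
  ∑ᶠ T ∈ {T : SemistandardYoungTableau μ | ∀ i j, (i, j) ∈ μ → T i j < N},
    ∏ p ∈ μ.cells, x (T p.1 p.2)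

/-- the dual symmetric Grothendieck polynomial `g_μ(x_1, …, x_n)` evaluated at real
arguments; variables are 0-indexed (`x ℓ` is the variable `x_{ℓ+1}`). -/
noncomputable def grothG (μ : YoungDiagram) (n : ℕ) (x : ℕ → ℝ) : ℝ :=
  ∑ᶠ π ∈ {π : PlanePartition | π.hasShape μ ∧ π.entriesLE n},
    ∏ ℓ ∈ Finset.range n, x ℓ ^ π.cCol (ℓ + 1)

/-- the elementary symmetric polynomial `e_m(x_1, …, x_n)` evaluated at real arguments. -/
noncomputable def esym (n : ℕ) (x : ℕ → ℝ) (m : ℕ) : ℝ :=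
  ∑ S ∈ (Finset.range n).powersetCard m, ∏ i ∈ S, x i

/-- `e_m` for an integer index `m`, with `e_m = 0` for `m < 0`. -/
noncomputable def esymZ (n : ℕ) (x : ℕ → ℝ) (m : ℤ) : ℝ :=
  if 0 ≤ m then esym n x m.toNat else 0

/-- the weight `∏_{(i,j) ∈ Des(π)} q_{π_{ij}}`; the parameters are 0-indexed
(`q ℓ` is the parameter `q_{ℓ+1}`). -/
noncomputable def desWeight (π : PlanePartition) (q : ℕ → ℝ) : ℝ :=
  ∏ᶠ p ∈ π.des, q (π.entry p.1 p.2 - 1)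

/-- the probability of a configuration `w` of a `b×c` matrix of i.i.d. Geom(q) entries,
where `P(entry = k) = (1-q) qᵏ`. -/
noncomputable def geomWeight (q : ℝ) (b c : ℕ) (w : Fin b × Fin c → ℕ) : ℝ :=
  ∏ p : Fin b × Fin c, ((1 - q) * q ^ w p)

/-- extend a `b×c` matrix to an `ℕ × ℕ`-indexed matrix by zero. -/
def matExt {b c : ℕ} (w : Fin b × Fin c → ℕ) : ℕ → ℕ → ℕ :=
  fun i j => if h : i < b ∧ j < c then w (⟨i, h.1⟩, ⟨j, h.2⟩) else 0


open Polynomial in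
/-- integer-indexed coefficient -/
noncomputable def czJT (p : ℝ[X]) (k : ℤ) : ℝ := if 0 ≤ k then p.coeff k.toNat else 0

open Polynomial in
lemma czJT_mul (p : ℝ[X]) (x : ℝ) (k : ℤ) :
    czJT ((1 + C x * X) * p) k = czJT p k + x * czJT p (k - 1) := by
  unfold czJT
  rcases lt_trichotomy k 0 with h | h | h
  · rw [if_neg (by omega), if_neg (by omega), if_neg (by omega)]; simp
  · subst h; simp [add_mul, mul_assoc]
  · obtain ⟨m, rfl⟩ : ∃ m : ℕ, k = m + 1 := ⟨(k-1).toNat, by omega⟩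
    rw [if_pos (by omega), if_pos (by omega), if_pos (by omega)]
    have h1 : ((m : ℤ) + 1).toNat = m + 1 := by omega
    have h2 : ((m : ℤ) + 1 - 1).toNat = m := by omega
    rw [h1, h2, add_mul, one_mul, mul_assoc, coeff_add, coeff_C_mul, coeff_X_mul]

open Polynomial in
/-- generating polynomial -/
noncomputable def genJT (k n : ℕ) (x : ℕ → ℝ) : ℝ[X] :=
  (1 + C 1 * X) ^ k * ∏ l ∈ Finset.range n, (1 + C (x l) * X)

open Polynomial in
lemma esym_eq_coeffJT (N : ℕ) (z : ℕ → ℝ) (m : ℕ) :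
    esym N z m = (∏ i ∈ Finset.range N, (1 + C (z i) * X)).coeff m := by
  rw [Finset.prod_one_add, finsetSum_coeff]
  unfold esym
  have : ∀ t ∈ (Finset.range N).powerset, (∏ i ∈ t, (C (z i) * X)).coeff m
      = if t.card = m then ∏ i ∈ t, z i else 0 := by
    intro t _
    rw [Finset.prod_mul_distrib, Finset.prod_const, ← map_prod, coeff_C_mul_X_pow]
    simp [eq_comm]
  rw [Finset.sum_congr rfl this, ← Finset.sum_filter, Finset.powersetCard_eq_filter]

lemma esymZ_eqJT (k n : ℕ) (x : ℕ → ℝ) (m : ℤ) :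
    esymZ (k + n) (oneExtend k x) m = czJT (genJT k n x) m := by
  unfold esymZ czJT genJT
  rw [esym_eq_coeffJT, Finset.prod_range_add]
  congr 4
  · rw [Finset.prod_congr rfl (g := fun _ => (1 + Polynomial.C 1 * Polynomial.X))]
    · simp
    · intro i hi
      simp [oneExtend, Finset.mem_range.1 hi]
  · simp [oneExtend]

lemma genJT_succ (k n : ℕ) (x : ℕ → ℝ) :
    genJT k (n + 1) x =
      (1 + Polynomial.C (x 0) * Polynomial.X) * genJT k n (fun i => x (i + 1)) := by
  unfold genJT
  rw [Finset.prod_range_succ']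
  ring

lemma genJT_succ' (k n : ℕ) (x : ℕ → ℝ) :
    genJT (k + 1) n x =
      (1 + Polynomial.C 1 * Polynomial.X) * genJT k n x := by
  unfold genJT
  ring

/-- rows of the matrix -/
noncomputable def rowJT (m n : ℕ) (x : ℕ → ℝ) (i b : ℕ) : Fin m → ℝ :=
  fun j => czJT (genJT (b - 1) n x) ((b : ℤ) - i + (j : ℕ))

lemma rowJT_sum (m n : ℕ) (x : ℕ → ℝ) (i b : ℕ) :
    ∑ c ∈ Finset.range (b + 1), rowJT m n x i c = rowJT m n x (i + 1) (b + 1) := by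
  induction b with
  | zero =>
    ext j
    simp [rowJT]
  | succ b ih =>
    rw [Finset.sum_range_succ, ih]
    ext j
    simp only [rowJT, Pi.add_apply, Nat.add_sub_cancel]
    rw [genJT_succ' b, czJT_mul, add_comm, one_mul]
    congr 2 <;> (push_cast; ring)

lemma rowJT_succ (m n : ℕ) (x : ℕ → ℝ) (i b : ℕ) :
    rowJT m (n + 1) x i b = rowJT m n (fun i => x (i + 1)) i b
      + x 0 • rowJT m n (fun i => x (i + 1)) (i + 1) b := by
  ext j
  simp only [rowJT, Pi.add_apply, Pi.smul_apply, smul_eq_mul]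
  rw [genJT_succ, czJT_mul]
  congr 3
  push_cast; ring

lemma rowJT_last (m n : ℕ) (x : ℕ → ℝ) : rowJT m n x m 0 = 0 := by
  ext j
  simp only [rowJT, czJT, Pi.zero_apply]
  rw [if_neg]
  have := j.2
  push_cast; omega

/-- bounded antitone sequences -/
noncomputable def antJT (k : ℕ) (a : Fin k → ℕ) : Finset (Fin k → ℕ) :=
  open Classical in (Fintype.piFinset fun i => Finset.range (a i + 1)).filter Antitone

lemma mem_antJT {k : ℕ} {a b : Fin k → ℕ} : b ∈ antJT k a ↔ (∀ i, b i ≤ a i) ∧ Antitone b := by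
  classical
  simp [antJT, Nat.lt_succ_iff]

/-- first entry or zero -/
def lowJT : (k : ℕ) → (Fin k → ℕ) → ℕ
  | 0, _ => 0
  | _ + 1, b => b 0

lemma antitone_consJT {k : ℕ} (c : ℕ) (b : Fin k → ℕ) :
    Antitone (Fin.cons c b : Fin (k + 1) → ℕ) ↔ lowJT k b ≤ c ∧ Antitone b := by
  cases k with
  | zero =>
    simp only [lowJT, Nat.zero_le, true_and]
    exact ⟨fun _ i => i.elim0, fun _ i j _ => by rw [show i = j from Fin.ext (by omega)]⟩
  | succ k =>
    rw [Fin.antitone_iff_succ_le (n := k + 1), Fin.forall_fin_succ, Fin.antitone_iff_succ_le]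
    simp only [lowJT]
    refine and_congr (by simp) ?_
    simp [← Fin.succ_castSucc]

lemma icc_sumJT {V : Type*} [AddCommGroup V] [Module ℝ V] (x : ℝ) (r : ℕ → ℕ → V)
    (H : ∀ i b, ∑ c ∈ Finset.range (b + 1), r i c = r (i + 1) (b + 1)) (lo a : ℕ) (h : lo ≤ a) :
    ∃ t : ℝ, ∑ c ∈ Finset.Ico lo (a + 1), (if c < a then x else 1) • r 0 c
      = r 0 a + x • r 1 a + t • r 1 lo := by
  rw [Finset.sum_Ico_succ_top h]
  have : ∑ c ∈ Finset.Ico lo a, (if c < a then x else 1) • r 0 c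
      = x • (∑ c ∈ Finset.range a, r 0 c - ∑ c ∈ Finset.range lo, r 0 c) := by
    rw [← Finset.sum_Ico_eq_sub _ h, Finset.smul_sum]
    refine Finset.sum_congr rfl fun c hc => ?_
    rw [if_pos (Finset.mem_Ico.1 hc).2]
  rw [this]
  rcases a with _ | a
  · obtain rfl : lo = 0 := by omega
    exact ⟨-x, by simp⟩
  · rw [H]
    rcases lo with _ | lo
    · exact ⟨0, by simp [add_comm]⟩
    · refine ⟨-x, ?_⟩
      rw [H]
      simp only [lt_irrefl, if_false, zero_add]
      module

lemma sum_applyJT {V ι : Type*} [AddCommGroup V] [Module ℝ V] {k : ℕ} (s : Finset ι)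
    (f : ι → V [⋀^Fin k]→ₗ[ℝ] ℝ) (v : Fin k → V) : (∑ c ∈ s, f c) v = ∑ c ∈ s, f c v := by
  classical
  induction s using Finset.induction_on with
  | empty => simp
  | insert a s ha ih => rw [Finset.sum_insert ha, Finset.sum_insert ha, ← ih]; rfl

lemma alt_sumJT {V : Type*} [AddCommGroup V] [Module ℝ V] (x : ℝ) (k : ℕ) :
    ∀ (r : ℕ → ℕ → V)
    (_ : ∀ i b, ∑ c ∈ Finset.range (b + 1), r i c = r (i + 1) (b + 1))
    (_ : r k 0 = 0) (a : Fin k → ℕ) (_ : Antitone a) (Φ : V [⋀^Fin k]→ₗ[ℝ] ℝ),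
    ∑ b ∈ antJT k a, (∏ i, if b i < a i then x else 1) * Φ (fun i => r i (b i))
      = Φ (fun i => r i (a i) + x • r (i + 1) (a i)) := by
  induction k with
  | zero =>
    intro r H h0 a ha Φ
    have : antJT 0 a = {a} := by
      ext b
      rw [mem_antJT, Finset.mem_singleton]
      exact ⟨fun _ => Subsingleton.elim _ _, fun _ => ⟨fun i => i.elim0, fun i => i.elim0⟩⟩
    rw [this]
    simp only [Finset.sum_singleton, Finset.univ_eq_empty, Finset.prod_empty, one_mul]
    congr 1
    exact Subsingleton.elim _ _
  | succ k ih =>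
    intro r H h0 a ha Φ
    have ha' : Antitone (fun i : Fin k => a i.succ) := fun i j h => ha (Fin.succ_le_succ_iff.2 h)
    have hlow : ∀ b ∈ antJT k (fun i => a i.succ), lowJT k b ≤ a 0 := by
      intro b hb
      rw [mem_antJT] at hb
      cases k with
      | zero => simp [lowJT]
      | succ k => exact (hb.1 0).trans (ha (Fin.zero_le _))
    have key : ∑ b ∈ antJT (k + 1) a, (∏ i, if b i < a i then x else 1) * Φ (fun i => r i (b i))
        = ∑ b ∈ antJT k (fun i => a i.succ), ∑ c ∈ Finset.Ico (lowJT k b) (a 0 + 1),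
          ((if c < a 0 then x else 1) * ∏ i : Fin k, if b i < a i.succ then x else 1) *
            Φ (Fin.cons (r 0 c) (fun i : Fin k => r (i + 1) (b i))) := by
      rw [Finset.sum_sigma']
      refine Finset.sum_bij' (fun b _ => ⟨Fin.tail b, b 0⟩) (fun p _ => Fin.cons p.2 p.1)
        ?_ ?_ ?_ ?_ ?_
      · intro b hb
        rw [mem_antJT] at hb
        have h2 := hb.2
        rw [← Fin.cons_self_tail b, antitone_consJT] at h2
        simp only [Finset.mem_sigma, mem_antJT, Finset.mem_Ico]
        exact ⟨⟨fun i => hb.1 i.succ, h2.2⟩, h2.1, Nat.lt_succ_of_le (hb.1 0)⟩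
      · rintro ⟨b, c⟩ hb
        simp only [Finset.mem_sigma, mem_antJT, Finset.mem_Ico] at hb
        rw [mem_antJT, antitone_consJT]
        refine ⟨fun i => ?_, hb.2.1, hb.1.2⟩
        refine Fin.cases ?_ (fun i => ?_) i
        · exact Nat.le_of_lt_succ hb.2.2
        · exact hb.1.1 i
      · intro b hb
        simp
      · rintro ⟨b, c⟩ hb
        simp
      · intro b hb
        rw [Fin.prod_univ_succ]
        congr 2
        ext i
        refine Fin.cases ?_ (fun i => ?_) i
        · simp
        · simp [Fin.tail]
    rw [key]
    have step : ∀ b ∈ antJT k (fun i => a i.succ), ∑ c ∈ Finset.Ico (lowJT k b) (a 0 + 1),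
          ((if c < a 0 then x else 1) * ∏ i : Fin k, if b i < a i.succ then x else 1) *
            Φ (Fin.cons (r 0 c) (fun i : Fin k => r (i + 1) (b i)))
        = (∏ i : Fin k, if b i < a i.succ then x else 1) *
          (Φ.curryLeft (r 0 (a 0) + x • r 1 (a 0))) (fun i : Fin k => r (i + 1) (b i)) := by
      intro b hb
      obtain ⟨t, ht⟩ := icc_sumJT x r H (lowJT k b) (a 0) (hlow b hb)
      have hz : Φ.curryLeft (r 1 (lowJT k b)) (fun i : Fin k => r (i + 1) (b i)) = 0 := by
        cases k with
        | zero =>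
          have : r 1 (lowJT 0 b) = 0 := h0
          rw [this, map_zero]; rfl
        | succ k =>
          rw [AlternatingMap.curryLeft_apply_apply]
          refine Φ.map_eq_zero_of_eq (i := 0) (j := 1) _ ?_ (by simp)
          simp [lowJT, Matrix.vecCons]
      have e : (Φ.curryLeft (r 0 (a 0) + x • r 1 (a 0))) (fun i : Fin k => r (i + 1) (b i))
          = ∑ c ∈ Finset.Ico (lowJT k b) (a 0 + 1), (if c < a 0 then x else 1) *
            Φ (Fin.cons (r 0 c) (fun i : Fin k => r (i + 1) (b i))) := by
        have e1 : (Φ.curryLeft (r 0 (a 0) + x • r 1 (a 0))) (fun i : Fin k => r (i + 1) (b i))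
          = (Φ.curryLeft (r 0 (a 0) + x • r 1 (a 0) + t • r 1 (lowJT k b)))
            (fun i : Fin k => r (i + 1) (b i)) := by
          rw [map_add Φ.curryLeft _ (t • _), map_smul Φ.curryLeft t, AlternatingMap.add_apply,
            AlternatingMap.smul_apply, hz, smul_zero, add_zero]
        rw [e1, ← ht, map_sum, sum_applyJT]
        refine Finset.sum_congr rfl fun c _ => ?_
        rw [map_smul, AlternatingMap.smul_apply, smul_eq_mul]
        rfl
      rw [e, Finset.mul_sum]
      exact Finset.sum_congr rfl fun c _ => by ring
    rw [Finset.sum_congr rfl step,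
      ih (fun i => r (i + 1)) (fun i b => H (i + 1) b) h0 (fun i => a i.succ) ha'
        (Φ.curryLeft (r 0 (a 0) + x • r 1 (a 0))), AlternatingMap.curryLeft_apply_apply]
    congr 1
    ext i
    refine Fin.cases ?_ (fun i => ?_) i
    · simp
    · simp

/-! Plane partitions -/

lemma PlanePartition.extJT {π σ : PlanePartition} (h : ∀ i j, π.entry i j = σ.entry i j) :
    π = σ := by
  cases π; cases σ
  congr
  funext i j
  exact h i j

/-- add one on the diagram -/
def liftJT (μ : YoungDiagram) (π : PlanePartition) : PlanePartition where
  entry i j := if (i, j) ∈ μ then π.entry i j + 1 else 0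
  row_decr i j := by
    split_ifs with h h'
    · exact Nat.succ_le_succ (π.row_decr i j)
    · exact absurd (μ.up_left_mem le_rfl (Nat.le_succ j) h) h'
    · simp
    · simp
  col_decr i j := by
    split_ifs with h h'
    · exact Nat.succ_le_succ (π.col_decr i j)
    · exact absurd (μ.up_left_mem (Nat.le_succ i) le_rfl h) h'
    · simp
    · simp
  finite_support := by
    refine μ.cells.finite_toSet.subset ?_
    rintro ⟨i, j⟩ h
    simp only [Set.mem_ofPred_eq] at h
    by_contra h'
    exact h (if_neg h')

/-- subtract one -/
def dropJT (π : PlanePartition) : PlanePartition where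
  entry i j := π.entry i j - 1
  row_decr i j := Nat.sub_le_sub_right (π.row_decr i j) 1
  col_decr i j := Nat.sub_le_sub_right (π.col_decr i j) 1
  finite_support := by
    refine π.finite_support.subset ?_
    rintro ⟨i, j⟩ h
    simp only [Set.mem_ofPred_eq] at h ⊢
    omega

/-- the subdiagram with given column bounds -/
def diagJT (μ : YoungDiagram) (m : ℕ) (b : Fin m → ℕ) : YoungDiagram where
  cells := μ.cells.filter fun p => ∀ j : Fin m, (j : ℕ) ≤ p.2 → p.1 < b j
  isLowerSet := by
    intro p q hle hp
    simp only [Finset.coe_filter, Set.mem_ofPred_eq] at hp ⊢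
    exact ⟨μ.isLowerSet hle hp.1, fun j hj => lt_of_le_of_lt hle.1 (hp.2 j (hj.trans hle.2))⟩

lemma diagJT_le (μ : YoungDiagram) (m : ℕ) (b : Fin m → ℕ) {p : ℕ × ℕ} (h : p ∈ diagJT μ m b) :
    p ∈ μ := (Finset.mem_filter.1 h).1

lemma mem_diagJT (μ : YoungDiagram) (m : ℕ) (b : Fin m → ℕ)
    (hb : b ∈ antJT m (fun j => μ.colLen j)) (i : ℕ) (j : Fin m) :
    (i, (j : ℕ)) ∈ diagJT μ m b ↔ i < b j := by
  rw [mem_antJT] at hb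
  constructor
  · intro h
    exact (Finset.mem_filter.1 h).2 j le_rfl
  · intro h
    refine Finset.mem_filter.2 ⟨?_, fun j' hj' => lt_of_lt_of_le h (hb.2 hj')⟩
    exact YoungDiagram.mem_iff_lt_colLen.2 (lt_of_lt_of_le h (hb.1 j))

lemma colLen_diagJT (μ : YoungDiagram) (m : ℕ) (b : Fin m → ℕ)
    (hb : b ∈ antJT m (fun j => μ.colLen j)) (j : Fin m) :
    (diagJT μ m b).colLen j = b j := by
  refine eq_of_forall_lt_iff fun i => ?_
  rw [← mem_diagJT μ m b hb, YoungDiagram.mem_iff_lt_colLen]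

lemma col_ltJT {μ : YoungDiagram} {m : ℕ} (hm : μ.rowLen 0 ≤ m) {i j : ℕ} (h : (i, j) ∈ μ) :
    j < m :=
  lt_of_lt_of_le (YoungDiagram.mem_iff_lt_rowLen.1 (μ.up_left_mem (Nat.zero_le i) le_rfl h)) hm

lemma rowLen_diagJT (μ : YoungDiagram) (m : ℕ) (b : Fin m → ℕ) (hm : μ.rowLen 0 ≤ m) :
    (diagJT μ m b).rowLen 0 ≤ m := by
  by_contra h
  push Not at h
  exact lt_irrefl _ (col_ltJT hm (diagJT_le _ _ _ (YoungDiagram.mem_iff_lt_rowLen.2 h)))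

/-- the indexing set -/
def setJT (μ : YoungDiagram) (n : ℕ) : Set PlanePartition := {π | π.hasShape μ ∧ π.entriesLE n}

lemma entry_antiJT (π : PlanePartition) {i j i' j' : ℕ} (hi : i ≤ i') (hj : j ≤ j') :
    π.entry i' j' ≤ π.entry i j :=
  (antitone_nat_of_succ_le (f := fun k => π.entry i' k) (π.row_decr i') hj).trans
    (antitone_nat_of_succ_le (f := fun k => π.entry k j) (fun k => π.col_decr k j) hi)

lemma setJT_succ (μ : YoungDiagram) (n m : ℕ) (hm : μ.rowLen 0 ≤ m) :
    setJT μ (n + 1) = liftJT μ ''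
      (⋃ b ∈ (antJT m (fun j => μ.colLen j) : Set (Fin m → ℕ)), setJT (diagJT μ m b) n) := by
  ext π
  simp only [Set.mem_image, Set.mem_iUnion, Finset.mem_coe]
  constructor
  · rintro ⟨h1, h2⟩
    let ν : YoungDiagram :=
      { cells := μ.cells.filter fun p => 1 < π.entry p.1 p.2
        isLowerSet := by
          intro p q hle hp
          simp only [Finset.coe_filter, Set.mem_ofPred_eq] at hp ⊢
          exact ⟨μ.isLowerSet hle hp.1, lt_of_lt_of_le hp.2 (entry_antiJT π hle.1 hle.2)⟩ }
    have hν : ∀ i j, (i, j) ∈ ν ↔ 1 < π.entry i j := fun i j =>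
      ⟨fun h => (Finset.mem_filter.1 h).2,
        fun h => Finset.mem_filter.2 ⟨(h1 i j).1 (by omega), h⟩⟩
    have hνμ : ∀ i j, (i, j) ∈ ν → (i, j) ∈ μ := fun i j h => (Finset.mem_filter.1 h).1
    have hb : (fun j : Fin m => ν.colLen j) ∈ antJT m (fun j => μ.colLen j) := by
      rw [mem_antJT]
      refine ⟨fun j => ?_, fun j j' h => ν.colLen_anti _ _ h⟩
      by_contra h
      push Not at h
      exact lt_irrefl _ (YoungDiagram.mem_iff_lt_colLen.1
        (hνμ _ _ (YoungDiagram.mem_iff_lt_colLen.2 h)))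
    refine ⟨dropJT π, ⟨_, hb, ?_, ?_⟩, ?_⟩
    · intro i j
      have e : 0 < (dropJT π).entry i j ↔ (i, j) ∈ ν := by
        rw [hν]; simp only [dropJT]; omega
      rw [e]
      constructor
      · intro h
        have := mem_diagJT μ m _ hb i ⟨j, col_ltJT hm (hνμ _ _ h)⟩
        exact this.2 (YoungDiagram.mem_iff_lt_colLen.1 h)
      · intro h
        have := mem_diagJT μ m _ hb i ⟨j, col_ltJT hm (diagJT_le _ _ _ h)⟩
        exact YoungDiagram.mem_iff_lt_colLen.2 (this.1 h)
    · intro i j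
      have := h2 i j
      simp only [dropJT]; omega
    · refine PlanePartition.extJT fun i j => ?_
      have := h1 i j
      simp only [liftJT, dropJT]
      split_ifs with h
      · have := this.2 h; omega
      · by_contra h'; exact h (this.1 (by omega))
  · rintro ⟨σ, ⟨b, hb, h1, h2⟩, rfl⟩
    refine ⟨fun i j => ?_, fun i j => ?_⟩
    · simp only [liftJT]
      split_ifs with h <;> simp [h]
    · have := h2 i j
      simp only [liftJT]
      split_ifs <;> omega

lemma setJT_zero_bot : setJT ⊥ 0 = {⟨fun _ _ => 0, by simp, by simp, by simp⟩} := by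
  ext π
  rw [Set.mem_singleton_iff]
  constructor
  · rintro ⟨_, h⟩
    exact PlanePartition.extJT fun i j => Nat.le_zero.1 (h i j)
  · rintro rfl
    exact ⟨fun i j => by simp, fun i j => le_rfl⟩

lemma setJT_zero {μ : YoungDiagram} (h : (0, 0) ∈ μ) : setJT μ 0 = ∅ := by
  rw [Set.eq_empty_iff_forall_notMem]
  rintro π ⟨h1, h2⟩
  have := (h1 0 0).2 h
  have := h2 0 0
  omega

lemma eq_botJT {μ : YoungDiagram} (h : (0, 0) ∉ μ) : μ = ⊥ := by
  ext ⟨i, j⟩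
  simp only [YoungDiagram.mem_cells, YoungDiagram.notMem_bot, iff_false]
  exact fun h' => h (μ.up_left_mem (Nat.zero_le _) (Nat.zero_le _) h')

lemma setJT_finite (n : ℕ) : ∀ μ, (setJT μ n).Finite := by
  induction n with
  | zero =>
    intro μ
    by_cases h : (0, 0) ∈ μ
    · rw [setJT_zero h]; exact Set.finite_empty
    · rw [eq_botJT h, setJT_zero_bot]; exact Set.finite_singleton _
  | succ n ih =>
    intro μ
    rw [setJT_succ μ n _ le_rfl]
    exact (Set.Finite.biUnion (Finset.finite_toSet _) fun b _ => ih _).image _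

lemma cCol_liftJT (μ ν : YoungDiagram) (hle : ∀ i j, (i, j) ∈ ν → (i, j) ∈ μ)
    (σ : PlanePartition) (hσ : σ.hasShape ν) (l : ℕ) :
    (liftJT μ σ).cCol (l + 1 + 1) = σ.cCol (l + 1) := by
  unfold PlanePartition.cCol
  congr 1
  ext j
  simp only [Set.mem_ofPred_eq, liftJT]
  refine exists_congr fun i => ?_
  split_ifs with h
  · omega
  · have h2 : ¬ 0 < σ.entry i j := fun h0 => h (hle i j ((hσ i j).1 h0))
    have h3 : σ.entry i j = 0 := by omega
    rw [h3]
    simp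

lemma cCol_lift_oneJT (μ ν : YoungDiagram) (m : ℕ) (hm : μ.rowLen 0 ≤ m)
    (σ : PlanePartition) (hσ : σ.hasShape ν) (x : ℝ) :
    x ^ (liftJT μ σ).cCol 1 = ∏ j : Fin m, if ν.colLen j < μ.colLen j then x else 1 := by
  rw [Finset.prod_range (n := m) (f := fun j => if ν.colLen j < μ.colLen j then x else 1) |>.symm]
  rw [Finset.prod_ite, Finset.prod_const, Finset.prod_const_one, mul_one]
  congr 1
  unfold PlanePartition.cCol
  rw [← Set.ncard_coe_finset]
  congr 1
  ext j
  simp only [Set.mem_ofPred_eq, liftJT, Finset.coe_filter, Finset.mem_range]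
  have hz : ∀ i, σ.entry i j = 0 ↔ ν.colLen j ≤ i := by
    intro i
    have := hσ i j
    rw [YoungDiagram.mem_iff_lt_colLen] at this
    omega
  constructor
  · rintro ⟨i, hi⟩
    split_ifs at hi with h
    refine ⟨col_ltJT hm h, lt_of_le_of_lt ((hz i).1 (by omega))
      (YoungDiagram.mem_iff_lt_colLen.1 h)⟩
  · rintro ⟨_, h⟩
    refine ⟨ν.colLen j, ?_⟩
    rw [if_pos (YoungDiagram.mem_iff_lt_colLen.2 h), (hz _).2 le_rfl]

lemma grothG_succJT (μ : YoungDiagram) (n m : ℕ) (hm : μ.rowLen 0 ≤ m) (x : ℕ → ℝ) :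
    grothG μ (n + 1) x = ∑ b ∈ antJT m (fun j => μ.colLen j),
      (∏ j : Fin m, if b j < μ.colLen j then x 0 else 1) *
        grothG (diagJT μ m b) n (fun i => x (i + 1)) := by
  have h1 : grothG μ (n + 1) x = ∑ᶠ π ∈ setJT μ (n + 1),
    ∏ l ∈ Finset.range (n + 1), x l ^ π.cCol (l + 1) := rfl
  rw [h1, setJT_succ μ n m hm, finsum_mem_image, finsum_mem_biUnion, finsum_mem_coe_finset]
  · refine Finset.sum_congr rfl fun b hb => ?_
    have h2 : grothG (diagJT μ m b) n (fun i => x (i + 1)) = ∑ᶠ π ∈ setJT (diagJT μ m b) n,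
      ∏ l ∈ Finset.range n, x (l + 1) ^ π.cCol (l + 1) := rfl
    rw [h2, mul_finsum_mem]
    refine finsum_mem_congr rfl fun σ hσ => ?_
    rw [Finset.prod_range_succ', mul_comm, zero_add,
      cCol_lift_oneJT μ (diagJT μ m b) m hm σ hσ.1]
    congr 1
    · refine Finset.prod_congr rfl fun j _ => ?_
      rw [colLen_diagJT μ m b hb]
    · refine Finset.prod_congr rfl fun l _ => ?_
      rw [cCol_liftJT μ (diagJT μ m b) (fun i j h => diagJT_le _ _ _ h) σ hσ.1]
  · intro b hb b' hb' hne
    refine Set.disjoint_left.2 fun σ h h' => hne ?_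
    funext j
    refine eq_of_forall_lt_iff fun i => ?_
    rw [← mem_diagJT μ m b hb, ← mem_diagJT μ m b' hb', ← h.1, ← h'.1]
  · exact Finset.finite_toSet _
  · exact fun b _ => setJT_finite _ _
  · intro σ hσ τ hτ h
    simp only [Set.mem_iUnion] at hσ hτ
    obtain ⟨b, _, hb⟩ := hσ
    obtain ⟨b', _, hb'⟩ := hτ
    refine PlanePartition.extJT fun i j => ?_
    have e : (liftJT μ σ).entry i j = (liftJT μ τ).entry i j := by rw [h]
    simp only [liftJT] at e
    split_ifs at e with hij
    · omega
    · have a1 := mt (hb.1 i j).1 (fun h => hij (diagJT_le _ _ _ h))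
      have a2 := mt (hb'.1 i j).1 (fun h => hij (diagJT_le _ _ _ h))
      omega

lemma grothG_rowJT (n : ℕ) : ∀ (μ : YoungDiagram) (m : ℕ) (_ : μ.rowLen 0 ≤ m) (x : ℕ → ℝ),
    grothG μ n x = Matrix.detRowAlternating (fun i : Fin m => rowJT m n x i (μ.colLen i)) := by
  induction n with
  | zero =>
    intro μ m hm x
    have h1 : grothG μ 0 x = ∑ᶠ π ∈ setJT μ 0,
      ∏ l ∈ Finset.range 0, x l ^ π.cCol (l + 1) := rfl
    rw [h1]
    by_cases h : (0, 0) ∈ μ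
    · rw [setJT_zero h, finsum_mem_empty]
      symm
      refine AlternatingMap.map_coord_zero _ ⟨0, col_ltJT hm h⟩ ?_
      have hp := YoungDiagram.mem_iff_lt_colLen.1 h
      ext j
      simp only [rowJT, czJT, genJT, Pi.zero_apply, Finset.range_zero, Finset.prod_empty, mul_one]
      split_ifs
      · refine Polynomial.coeff_eq_zero_of_natDegree_lt ?_
        have d1 : (1 + Polynomial.C (1 : ℝ) * Polynomial.X).natDegree ≤ 1 := by
          compute_degree
        have d2 := Polynomial.natDegree_pow_le_of_le (μ.colLen 0 - 1) d1
        refine lt_of_le_of_lt d2 ?_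
        push_cast
        omega
      · rfl
    · rw [eq_botJT h, setJT_zero_bot, finsum_mem_singleton]
      have hc : ∀ j, (⊥ : YoungDiagram).colLen j = 0 := by
        intro j
        by_contra h
        exact YoungDiagram.notMem_bot _ (YoungDiagram.mem_iff_lt_colLen.2 (Nat.pos_of_ne_zero h))
      simp only [hc]
      have : (fun i : Fin m => rowJT m 0 x i 0) = (1 : Matrix (Fin m) (Fin m) ℝ) := by
        ext i j
        simp only [rowJT, czJT, genJT, Matrix.one_apply]
        simp only [Finset.range_zero, Finset.prod_empty, mul_one, Nat.zero_sub, pow_zero,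
          Polynomial.coeff_one, Fin.ext_iff]
        split_ifs <;> first | rfl | (exfalso; omega)
      rw [this]
      exact (by simp : (1 : ℝ) = Matrix.det (1 : Matrix (Fin m) (Fin m) ℝ))
  | succ n ih =>
    intro μ m hm x
    rw [grothG_succJT μ n m hm]
    simp only [rowJT_succ]
    rw [← alt_sumJT (x 0) m (rowJT m n (fun i => x (i + 1))) (rowJT_sum _ _ _) (rowJT_last _ _ _)
      (fun j => μ.colLen j) (fun j j' h => μ.colLen_anti _ _ h)]
    refine Finset.sum_congr rfl fun b hb => ?_
    rw [ih _ m (rowLen_diagJT μ m b hm)]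
    congr 3
    ext i : 1
    rw [colLen_diagJT μ m b hb]

theorem grothG_jacobiTrudi (μ : YoungDiagram) (n : ℕ) (x : ℕ → ℝ) :
    grothG μ n x =
      Matrix.det (fun i j : Fin (μ.rowLen 0) =>
        esymZ (μ.colLen i - 1 + n) (oneExtend (μ.colLen i - 1) x)
          ((μ.colLen i : ℤ) - (i : ℤ) + (j : ℤ))) := by
  rw [grothG_rowJT n μ _ le_rfl x]
  simp only [esymZ_eqJT]
  rfl
end

section
/- Coincidence lemma: for all positive integers a, b and n ≥ 1, g_{(a^b)}(x_1,…,x_n) = s_{(a^b)}(1^{b−1}, x_1,…,x_n), where (a^b) is the rectangular partition with b parts equal to a and the right-hand side is the Schur polynomial in b−1+n variables with the first b−1 variables specialized to 1. -/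
open scoped BigOperators

/-- Arrays on the `b × n` box, weakly decreasing, with first column equal to `a`. -/
def ArrP (a b n : ℕ) : Set (ℕ → ℕ → ℕ) :=
  {G | (∀ i l, G (i + 1) l ≤ G i l) ∧ (∀ i l, G i (l + 1) ≤ G i l) ∧
    (∀ i l, b ≤ i → G i l = 0) ∧ (∀ i l, n ≤ l → G i l = 0) ∧ ∀ i, i < b → G i 0 = a}

/-- toggle the diagonal strictly below-right of `(i, l)`. -/
def togD (i l : ℕ) (f : ℕ → ℕ → ℕ) : ℕ → ℕ → ℕ := fun p q =>
  if i < p ∧ p + l = q + i then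
    min (f (p - 1) q) (f p (q - 1)) + max (f (p + 1) q) (f p (q + 1)) - f p q
  else f p q

/-- local last-passage weights. -/
def locD (f : ℕ → ℕ → ℕ) (i l : ℕ) : ℕ := f i l - max (f (i + 1) l) (f i (l + 1))

/-- diagonal sums -/
def diagS (b : ℕ) (f : ℕ → ℕ → ℕ) (i l : ℕ) : ℕ := ∑ k ∈ Finset.range b, f (i + k) (l + k)

lemma togD_diag (i l : ℕ) (f : ℕ → ℕ → ℕ) (k : ℕ) : togD i l f (i + (k + 1)) (l + (k + 1)) =
    min (f (i + k) (l + (k + 1))) (f (i + (k + 1)) (l + k)) +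
      max (f (i + (k + 1) + 1) (l + (k + 1))) (f (i + (k + 1)) (l + (k + 1) + 1))
      - f (i + (k + 1)) (l + (k + 1)) := by
  unfold togD
  rw [if_pos ⟨by omega, by omega⟩]
  rfl

lemma togD_off {i l p q : ℕ} (f : ℕ → ℕ → ℕ) (h : ¬ (i < p ∧ p + l = q + i)) :
    togD i l f p q = f p q := if_neg h

lemma togD_mem {a b n i l : ℕ} {f : ℕ → ℕ → ℕ} (hf : f ∈ ArrP a b n) :
    togD i l f ∈ ArrP a b n := by
  obtain ⟨h1, h2, h3, h4, h5⟩ := hf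
  refine ⟨?_, ?_, ?_, ?_, ?_⟩
  · intro p q
    by_cases hA : i < p + 1 ∧ p + 1 + l = q + i
    · obtain ⟨k, rfl⟩ : ∃ k, p = i + k := ⟨p - i, by omega⟩
      obtain rfl : q = l + (k + 1) := by omega
      rw [togD_off f (p := i + k) (by omega)]
      have := togD_diag i l f k
      have e1 := h2 (i + (k + 1)) (l + (k + 1))
      have e2 := h1 (i + (k + 1)) (l + (k + 1))
      rw [show i + k + 1 = i + (k + 1) by omega, this]
      omega
    · rw [togD_off f hA]
      by_cases hB : i < p ∧ p + l = q + i
      · obtain ⟨k, rfl⟩ : ∃ k, p = i + (k + 1) := ⟨p - i - 1, by omega⟩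
        obtain rfl : q = l + (k + 1) := by omega
        rw [togD_diag]
        have e1 := h1 (i + k) (l + (k + 1))
        have e2 := h2 (i + (k + 1)) (l + k)
        rw [show i + k + 1 = i + (k + 1) by omega] at e1
        rw [show l + k + 1 = l + (k + 1) by omega] at e2
        omega
      · rw [togD_off f hB]; exact h1 p q
  · intro p q
    by_cases hA : i < p ∧ p + l = q + 1 + i
    · obtain ⟨k, rfl⟩ : ∃ k, p = i + (k + 1) := ⟨p - i - 1, by omega⟩
      obtain rfl : q = l + k := by omega
      rw [togD_off f (q := l + k) (by omega)]
      have := togD_diag i l f k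
      have e1 := h2 (i + (k + 1)) (l + (k + 1))
      have e2 := h1 (i + (k + 1)) (l + (k + 1))
      rw [show l + k + 1 = l + (k + 1) by omega, this]
      omega
    · rw [togD_off f hA]
      by_cases hB : i < p ∧ p + l = q + i
      · obtain ⟨k, rfl⟩ : ∃ k, p = i + (k + 1) := ⟨p - i - 1, by omega⟩
        obtain rfl : q = l + (k + 1) := by omega
        rw [togD_diag]
        have e1 := h1 (i + k) (l + (k + 1))
        have e2 := h2 (i + (k + 1)) (l + k)
        rw [show i + k + 1 = i + (k + 1) by omega] at e1
        rw [show l + k + 1 = l + (k + 1) by omega] at e2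
        omega
      · rw [togD_off f hB]; exact h2 p q
  · intro p q hp
    unfold togD
    have := h3 p q hp
    have := h3 p (q - 1) hp
    have := h3 (p + 1) q (by omega)
    have := h3 p (q + 1) hp
    split_ifs <;> omega
  · intro p q hp
    unfold togD
    have := h4 p q hp
    have := h4 (p - 1) q hp
    have := h4 (p + 1) q hp
    have := h4 p (q + 1) (by omega)
    split_ifs <;> omega
  · intro p hp
    rw [togD_off f (by omega)]
    exact h5 p hp

lemma togD_invol {a b n i l : ℕ} {f : ℕ → ℕ → ℕ} (hf : f ∈ ArrP a b n) :
    togD i l (togD i l f) = f := by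
  obtain ⟨h1, h2, h3, h4, h5⟩ := hf
  funext p q
  by_cases hB : i < p ∧ p + l = q + i
  · obtain ⟨k, rfl⟩ : ∃ k, p = i + (k + 1) := ⟨p - i - 1, by omega⟩
    obtain rfl : q = l + (k + 1) := by omega
    rw [togD_diag, togD_diag, togD_off f (by omega), togD_off f (by omega),
      togD_off f (by omega), togD_off f (by omega)]
    have e1 := h1 (i + k) (l + (k + 1))
    have e2 := h2 (i + (k + 1)) (l + k)
    rw [show i + k + 1 = i + (k + 1) by omega] at e1
    rw [show l + k + 1 = l + (k + 1) by omega] at e2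
    omega
  · rw [togD_off _ hB, togD_off _ hB]

lemma togD_bij (a b n i l : ℕ) : Set.BijOn (togD i l) (ArrP a b n) (ArrP a b n) :=
  Set.InvOn.bijOn (f' := togD i l) ⟨fun _ hf => togD_invol hf, fun _ hf => togD_invol hf⟩
    (fun _ hf => togD_mem hf) (fun _ hf => togD_mem hf)

lemma togD_sum_aux {a b n i l : ℕ} {f : ℕ → ℕ → ℕ} (hf : f ∈ ArrP a b n) (K : ℕ) :
    ∑ k ∈ Finset.range (K + 1), togD i l f (i + k) (l + k)
      + ∑ k ∈ Finset.range K, f (i + 1 + k) (l + 1 + k)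
    = locD f i l + ∑ k ∈ Finset.range K, f (i + 1 + k) (l + k)
      + ∑ k ∈ Finset.range K, f (i + k) (l + 1 + k)
      + max (f (i + 1 + K) (l + K)) (f (i + K) (l + 1 + K)) := by
  obtain ⟨h1, h2, h3, h4, h5⟩ := hf
  induction K with
  | zero =>
    simp only [zero_add, Finset.range_one, Finset.sum_singleton, Finset.range_zero,
      Finset.sum_empty, add_zero]
    rw [togD_off f (by omega)]
    have := h1 i l
    have := h2 i l
    unfold locD
    omega
  | succ K ih =>
    rw [Finset.sum_range_succ _ (K + 1), Finset.sum_range_succ (fun k => f (i + 1 + k) (l + 1 + k)),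
      Finset.sum_range_succ (fun k => f (i + 1 + k) (l + k)),
      Finset.sum_range_succ (fun k => f (i + k) (l + 1 + k)), togD_diag]
    have e1 := h1 (i + K) (l + (K + 1))
    have e2 := h2 (i + (K + 1)) (l + K)
    have r1 : i + K + 1 = i + (K + 1) := by omega
    have r2 : l + K + 1 = l + (K + 1) := by omega
    have r3 : i + 1 + K = i + (K + 1) := by omega
    have r4 : l + 1 + K = l + (K + 1) := by omega
    have r5 : i + 1 + (K + 1) = i + (K + 1) + 1 := by omega
    have r6 : l + 1 + (K + 1) = l + (K + 1) + 1 := by omega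
    rw [r1] at e1
    rw [r2] at e2
    rw [r3, r4] at ih ⊢
    rw [r5, r6]
    omega

lemma togD_sum {a b n i l : ℕ} {f : ℕ → ℕ → ℕ} (hf : f ∈ ArrP a b n) :
    diagS b (togD i l f) i l + diagS b f (i + 1) (l + 1)
    = locD f i l + diagS b f (i + 1) l + diagS b f i (l + 1) := by
  have h := togD_sum_aux (i := i) (l := l) hf b
  have hg := togD_mem (i := i) (l := l) hf
  rw [Finset.sum_range_succ, hg.2.2.1 (i + b) _ (by omega), hf.2.2.1 (i + 1 + b) _ (by omega),
    hf.2.2.1 (i + b) _ (by omega)] at h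
  simpa [diagS] using h

/-- the column statistic -/
def colW (b : ℕ) (f : ℕ → ℕ → ℕ) (i l : ℕ) : ℤ :=
  ∑ p ∈ Finset.range i, (locD f p l : ℤ) + diagS b f i l - diagS b f i (l + 1)

lemma diagS_tog_off {b i l p q : ℕ} (f : ℕ → ℕ → ℕ) (h : p + l ≠ q + i) :
    diagS b (togD i l f) p q = diagS b f p q := by
  unfold diagS
  exact Finset.sum_congr rfl fun k _ => togD_off f (by omega)

lemma togD_colW {a b n i l : ℕ} {f : ℕ → ℕ → ℕ} (hf : f ∈ ArrP a b n) :
    colW b f (i + 1) l = colW b (togD i l f) i l := by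
  have h := togD_sum (i := i) (l := l) hf
  unfold colW
  rw [Finset.sum_range_succ, diagS_tog_off (p := i) (q := l + 1) f (by omega)]
  have : ∑ p ∈ Finset.range i, (locD (togD i l f) p l : ℤ)
      = ∑ p ∈ Finset.range i, (locD f p l : ℤ) := by
    refine Finset.sum_congr rfl fun p hp => ?_
    rw [Finset.mem_range] at hp
    unfold locD
    rw [togD_off f (by omega), togD_off f (by omega), togD_off f (by omega)]
  rw [this]
  zify at h
  linarith

lemma col_step (a b n l : ℕ) (i : ℕ) : ∃ e : (ℕ → ℕ → ℕ) → (ℕ → ℕ → ℕ),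
    Set.BijOn e (ArrP a b n) (ArrP a b n) ∧ ∀ f ∈ ArrP a b n,
      colW b f i l = colW b (e f) 0 l ∧ (∀ p q, q ≤ l → e f p q = f p q) ∧
      ∀ q, l < q → diagS b (e f) 0 q = diagS b f 0 q := by
  induction i with
  | zero => exact ⟨id, Set.bijOn_id _, fun f _ => ⟨rfl, fun _ _ _ => rfl, fun _ _ => rfl⟩⟩
  | succ i ih =>
    obtain ⟨e, he, h⟩ := ih
    refine ⟨e ∘ togD i l, he.comp (togD_bij a b n i l), fun f hf => ?_⟩
    obtain ⟨h1, h2, h3⟩ := h _ (togD_mem (i := i) (l := l) hf)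
    refine ⟨(togD_colW hf).trans h1, fun p q hq => ?_, fun q hq => ?_⟩
    · exact (h2 p q hq).trans (togD_off f (by omega))
    · exact (h3 q hq).trans (diagS_tog_off f (by omega))

lemma all_step (a b n : ℕ) (L : ℕ) : ∃ e : (ℕ → ℕ → ℕ) → (ℕ → ℕ → ℕ),
    Set.BijOn e (ArrP a b n) (ArrP a b n) ∧ ∀ f ∈ ArrP a b n,
      (∀ q, q < L → ∑ p ∈ Finset.range b, (locD f p q : ℤ) = colW b (e f) 0 q) ∧
      ∀ q, L ≤ q → diagS b (e f) 0 q = diagS b f 0 q := by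
  induction L with
  | zero => exact ⟨id, Set.bijOn_id _, fun f _ => ⟨fun _ h => absurd h (by omega), fun _ _ => rfl⟩⟩
  | succ L ih =>
    obtain ⟨e, he, h⟩ := ih
    obtain ⟨c, hc, h'⟩ := col_step a b n L b
    refine ⟨e ∘ c, he.comp hc, fun f hf => ?_⟩
    obtain ⟨h1, h2, h3⟩ := h' f hf
    obtain ⟨g1, g2⟩ := h _ (hc.mapsTo hf)
    refine ⟨fun q hq => ?_, fun q hq => (g2 q (by omega)).trans (h3 q (by omega))⟩
    rcases Nat.lt_succ_iff_lt_or_eq.mp hq with hq | rfl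
    · rw [Function.comp, ← g1 q hq]
      refine Finset.sum_congr rfl fun p _ => ?_
      unfold locD
      rw [h2 _ _ (by omega), h2 _ _ (by omega), h2 _ _ (by omega)]
    · have z : ∀ t, diagS b f b t = 0 := fun t =>
        Finset.sum_eq_zero fun k _ => hf.2.2.1 _ _ (by omega)
      have : colW b f b q = ∑ p ∈ Finset.range b, (locD f p q : ℤ) := by
        unfold colW; rw [z, z]; simp
      rw [← this, h1]
      unfold colW
      simp only [Function.comp, Finset.range_zero, Finset.sum_empty, zero_add]
      rw [g2 q le_rfl, g2 (q + 1) (by omega)]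

/-- conjugate of a sequence -/
def conjS (m : ℕ) (h : ℕ → ℕ) (l : ℕ) : ℕ := ((Finset.range m).filter fun j => l < h j).card

lemma conjS_lt {m : ℕ} {h : ℕ → ℕ} (hh : ∀ j, h (j + 1) ≤ h j) (hz : ∀ j, m ≤ j → h j = 0)
    (j l : ℕ) : j < conjS m h l ↔ l < h j := by
  have anti : Antitone h := antitone_nat_of_succ_le hh
  constructor
  · intro hj
    by_contra hc
    have : (Finset.range m).filter (fun j => l < h j) ⊆ Finset.range j := by
      intro t ht
      simp only [Finset.mem_filter, Finset.mem_range] at ht ⊢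
      by_contra ht'
      have := anti (not_lt.mp ht')
      omega
    have := Finset.card_le_card this
    rw [Finset.card_range] at this
    unfold conjS at hj
    omega
  · intro hl
    have : Finset.range (j + 1) ⊆ (Finset.range m).filter (fun j => l < h j) := by
      intro t ht
      simp only [Finset.mem_filter, Finset.mem_range] at ht ⊢
      have := anti (show t ≤ j by omega)
      refine ⟨?_, by omega⟩
      by_contra hm
      have := hz t (by omega)
      omega
    have := Finset.card_le_card this
    rw [Finset.card_range] at this
    unfold conjS
    omega

lemma nat_eq_of_lt {x y : ℕ} (h : ∀ t, t < x ↔ t < y) : x = y := by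
  have := h x
  have := h y
  omega

/-- plane partitions of rectangular shape -/
def RectPP (a b n : ℕ) : Set PlanePartition :=
  {π | π.hasShape (rectDiagram a b) ∧ π.entriesLE n}

lemma mem_rect {a b i j : ℕ} : (i, j) ∈ rectDiagram a b ↔ i < b ∧ j < a := by
  rw [← YoungDiagram.mem_cells]
  simp [rectDiagram]

lemma PP_ext {π ρ : PlanePartition} (h : ∀ i j, π.entry i j = ρ.entry i j) : π = ρ := by
  cases π; cases ρ
  simp only [PlanePartition.mk.injEq]
  funext i j
  exact h i j

lemma RectPP_zero {a b n : ℕ} {π : PlanePartition} (h : π ∈ RectPP a b n) (i j : ℕ)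
    (hij : ¬ (i < b ∧ j < a)) : π.entry i j = 0 := by
  have := (h.1 i j).not
  rw [mem_rect] at this
  have := this.mpr hij
  omega

lemma RectPP_pos {a b n : ℕ} {π : PlanePartition} (h : π ∈ RectPP a b n) {i j : ℕ}
    (hi : i < b) (hj : j < a) : 0 < π.entry i j := (h.1 i j).mpr (mem_rect.mpr ⟨hi, hj⟩)

/-- from plane partitions to arrays of row lengths -/
def toArr (a : ℕ) (π : PlanePartition) : ℕ → ℕ → ℕ := fun i l => conjS a (π.entry i) l

lemma toArr_lt {a b n : ℕ} {π : PlanePartition} (h : π ∈ RectPP a b n) (i j l : ℕ) :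
    j < toArr a π i l ↔ l < π.entry i j :=
  conjS_lt (π.row_decr i) (fun j hj => RectPP_zero h i j (by omega)) j l

lemma le_of_lt_imp {x y : ℕ} (h : ∀ t, t < x → t < y) : x ≤ y := by
  by_contra hc
  have := h y (by omega)
  omega

lemma toArr_mem {a b n : ℕ} {π : PlanePartition} (h : π ∈ RectPP a b n) :
    toArr a π ∈ ArrP a b n := by
  have key := toArr_lt h
  refine ⟨fun i l => ?_, fun i l => ?_, fun i l hi => ?_, fun i l hl => ?_, fun i hi => ?_⟩
  · refine le_of_lt_imp fun t ht => ?_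
    rw [key] at ht ⊢
    exact ht.trans_le (π.col_decr i t)
  · refine le_of_lt_imp fun t ht => ?_
    rw [key] at ht ⊢
    omega
  · refine Nat.eq_zero_of_not_pos fun ht => ?_
    rw [key, RectPP_zero h i 0 (by omega)] at ht
    omega
  · refine Nat.eq_zero_of_not_pos fun ht => ?_
    rw [key] at ht
    have := h.2 i 0
    omega
  · refine nat_eq_of_lt fun t => ?_
    rw [key]
    by_cases ht : t < a
    · exact ⟨fun _ => ht, fun _ => RectPP_pos h hi ht⟩
    · rw [RectPP_zero h i t (by omega)]
      omega

lemma toArr_bij (a b n : ℕ) : Set.BijOn (toArr a) (RectPP a b n) (ArrP a b n) := by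
  refine ⟨fun π h => toArr_mem h, fun π h ρ h' e => ?_, fun G hG => ?_⟩
  · refine PP_ext fun i j => nat_eq_of_lt fun t => ?_
    rw [← toArr_lt h, ← toArr_lt h', e]
  · obtain ⟨h1, h2, h3, h4, h5⟩ := hG
    have key : ∀ i l j, l < conjS n (G i) j ↔ j < G i l := fun i l j =>
      conjS_lt (h2 i) (h4 i) l j
    have hpos : ∀ i j, 0 < conjS n (G i) j ↔ i < b ∧ j < a := by
      intro i j
      rw [key]
      by_cases hi : i < b
      · rw [h5 i hi]; simp [hi]
      · rw [h3 i 0 (by omega)]; simp [hi]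
    let π : PlanePartition :=
      { entry := fun i j => conjS n (G i) j
        row_decr := fun i j => le_of_lt_imp fun t ht => by
          rw [key] at ht ⊢; omega
        col_decr := fun i j => le_of_lt_imp fun t ht => by
          rw [key] at ht ⊢; exact ht.trans_le (h1 i t)
        finite_support := by
          refine (Finset.finite_toSet (Finset.range b ×ˢ Finset.range a)).subset ?_
          intro p hp
          have := (hpos p.1 p.2).mp (Nat.pos_of_ne_zero hp)
          simpa using this }
    have hπ : π ∈ RectPP a b n := by
      refine ⟨fun i j => (hpos i j).trans mem_rect.symm, fun i j => le_of_lt_imp fun t ht => ?_⟩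
      have ht' : t < conjS n (G i) j := ht
      rw [key] at ht'
      by_contra hc
      rw [h4 i t (by omega)] at ht'
      omega
    refine ⟨π, hπ, ?_⟩
    funext i l
    refine nat_eq_of_lt fun t => ?_
    rw [toArr_lt hπ]
    exact key i l t

lemma PP_anti (π : PlanePartition) (j : ℕ) : Antitone (fun i => π.entry i j) :=
  antitone_nat_of_succ_le fun i => π.col_decr i j

lemma cCol_eq {a b n : ℕ} {π : PlanePartition} (h : π ∈ RectPP a b n) (l : ℕ) :
    π.cCol (l + 1) = ∑ p ∈ Finset.range b, locD (toArr a π) p l := by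
  have key := toArr_lt h
  have mem : ∀ p j, j ∈ Finset.Ico (max (toArr a π (p + 1) l) (toArr a π p (l + 1)))
      (toArr a π p l) ↔ π.entry p j = l + 1 ∧ π.entry (p + 1) j ≤ l := by
    intro p j
    have k1 := key p j l
    have k2 := key p j (l + 1)
    have k3 := key (p + 1) j l
    rw [Finset.mem_Ico]
    omega
  have hset : {j | ∃ i, π.entry i j = l + 1} =
      ((Finset.range b).biUnion fun p =>
        Finset.Ico (max (toArr a π (p + 1) l) (toArr a π p (l + 1))) (toArr a π p l) : Finset ℕ) := by
    ext j
    simp only [Set.mem_ofPred_eq, Finset.coe_biUnion, Set.mem_iUnion, Finset.mem_coe, mem,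
      Finset.mem_range]
    constructor
    · rintro ⟨i, hi⟩
      have hex : ∃ m, π.entry m j ≤ l := ⟨b, by rw [RectPP_zero h b j (by omega)]; omega⟩
      have hf := Nat.find_spec hex
      have hm := fun m => @Nat.find_min _ _ hex m
      generalize Nat.find hex = m at hf hm
      have him : i < m := by
        by_contra hc
        have : π.entry i j ≤ π.entry m j := PP_anti π j (not_lt.mp hc)
        omega
      obtain ⟨m, rfl⟩ : ∃ k, m = k + 1 := ⟨m - 1, by omega⟩
      have h1 := hm m (by omega)
      have h2 : π.entry m j ≤ π.entry i j := PP_anti π j (show i ≤ m by omega)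
      refine ⟨m, ?_, by omega, hf⟩
      by_contra hc
      rw [RectPP_zero h m j (by omega)] at h1
      omega
    · rintro ⟨p, _, hp, _⟩
      exact ⟨p, hp⟩
  have hlt : ∀ p q j, p < q → π.entry (p + 1) j ≤ l → π.entry q j ≠ l + 1 := by
    intro p q j hpq h1 h2
    have : π.entry q j ≤ π.entry (p + 1) j := PP_anti π j (show p + 1 ≤ q by omega)
    omega
  unfold PlanePartition.cCol
  rw [hset, Set.ncard_coe_finset, Finset.card_biUnion]
  · refine Finset.sum_congr rfl fun p _ => ?_
    rw [Nat.card_Ico]; rfl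
  · intro p _ q _ hpq
    refine Finset.disjoint_left.mpr ?_
    intro j h1 h2
    rw [mem] at h1 h2
    rcases lt_or_gt_of_ne hpq with hh | hh
    · exact hlt p q j hh h1.2 h2.1
    · exact hlt q p j hh h2.2 h1.1

/-- diagonal statistic of a plane partition -/
def diagN (a b : ℕ) (π : PlanePartition) (l : ℕ) : ℕ :=
  ∑ k ∈ Finset.range b, ((Finset.range a).filter fun j => π.entry k j = k + l + 1).card

lemma diagN_eq {a b n : ℕ} {π : PlanePartition} (h : π ∈ RectPP a b n) (l : ℕ) :
    (diagN a b π l : ℤ) = colW b (toArr a π) 0 l := by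
  have key := toArr_lt h
  have h2 := (toArr_mem h).2.1
  unfold colW diagN diagS
  simp only [Finset.range_zero, Finset.sum_empty, zero_add]
  push_cast
  rw [← Finset.sum_sub_distrib]
  refine Finset.sum_congr rfl fun k _ => ?_
  have : (Finset.range a).filter (fun j => π.entry k j = k + l + 1) =
      Finset.Ico (toArr a π k (l + k + 1)) (toArr a π k (l + k)) := by
    ext j
    have k1 := key k j (l + k)
    have k2 := key k j (l + k + 1)
    have k3 := RectPP_zero h k j
    rw [Finset.mem_Ico, Finset.mem_filter, Finset.mem_range]
    omega
  rw [this, Nat.card_Ico, Nat.cast_sub (h2 k (l + k)), show l + 1 + k = l + k + 1 by omega]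

/-- bounded tableaux -/
def RectT (a b n : ℕ) : Set (SemistandardYoungTableau (rectDiagram a b)) :=
  {T | ∀ i j, (i, j) ∈ rectDiagram a b → T i j < b - 1 + n}

lemma T_lower {a b : ℕ} (T : SemistandardYoungTableau (rectDiagram a b)) {j : ℕ} (hj : j < a)
    (i : ℕ) (hi : i < b) : i ≤ T i j := by
  induction i with
  | zero => omega
  | succ i ih =>
    have := ih (by omega)
    have := T.col_strict (i1 := i) (i2 := i + 1) (by omega) (mem_rect.mpr ⟨hi, hj⟩)
    omega

lemma T_upper {a b n : ℕ} {T : SemistandardYoungTableau (rectDiagram a b)} (hT : T ∈ RectT a b n)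
    {j : ℕ} (hj : j < a) (k : ℕ) (hk : k < b) : T (b - 1 - k) j + k + 1 ≤ b - 1 + n := by
  induction k with
  | zero => exact hT _ _ (mem_rect.mpr ⟨by omega, hj⟩)
  | succ k ih =>
    have := ih (by omega)
    have := T.col_strict (i1 := b - 1 - (k + 1)) (i2 := b - 1 - k) (j := j) (by omega)
      (mem_rect.mpr ⟨by omega, hj⟩)
    omega

/-- tableau to plane partition -/
def TtoPP (a b : ℕ) (T : SemistandardYoungTableau (rectDiagram a b)) : PlanePartition where
  entry k j := if k < b ∧ j < a then T (b - 1 - k) (a - 1 - j) - (b - 1 - k) + 1 else 0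
  row_decr k j := by
    by_cases h : k < b ∧ j + 1 < a
    · rw [if_pos h, if_pos (by omega)]
      have := T.row_weak (i := b - 1 - k) (j1 := a - 1 - (j + 1)) (j2 := a - 1 - j) (by omega)
        (mem_rect.mpr ⟨by omega, by omega⟩)
      omega
    · rw [if_neg h]; omega
  col_decr k j := by
    by_cases h : k + 1 < b ∧ j < a
    · rw [if_pos h, if_pos (by omega)]
      have := T.col_strict (i1 := b - 1 - (k + 1)) (i2 := b - 1 - k) (j := a - 1 - j) (by omega)
        (mem_rect.mpr ⟨by omega, by omega⟩)
      omega
    · rw [if_neg h]; omega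
  finite_support := by
    refine (Finset.finite_toSet (Finset.range b ×ˢ Finset.range a)).subset ?_
    intro p hp
    by_contra hc
    simp only [Finset.coe_product, Set.mem_prod, Finset.mem_coe, Finset.mem_range] at hc
    exact hp (if_neg hc)

lemma TtoPP_pos {a b : ℕ} (T : SemistandardYoungTableau (rectDiagram a b)) {k j : ℕ}
    (hk : k < b) (hj : j < a) :
    (TtoPP a b T).entry k j = T (b - 1 - k) (a - 1 - j) - (b - 1 - k) + 1 :=
  if_pos ⟨hk, hj⟩

lemma TtoPP_neg {a b : ℕ} (T : SemistandardYoungTableau (rectDiagram a b)) {k j : ℕ}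
    (h : ¬ (k < b ∧ j < a)) : (TtoPP a b T).entry k j = 0 :=
  if_neg h

lemma TtoPP_mem {a b n : ℕ} {T : SemistandardYoungTableau (rectDiagram a b)}
    (hT : T ∈ RectT a b n) : TtoPP a b T ∈ RectPP a b n := by
  refine ⟨fun k j => ?_, fun k j => ?_⟩
  · rw [mem_rect]
    by_cases h : k < b ∧ j < a
    · rw [TtoPP_pos T h.1 h.2]; exact ⟨fun _ => h, fun _ => by omega⟩
    · rw [TtoPP_neg T h]; exact ⟨fun h' => by omega, fun h' => absurd h' h⟩
  · by_cases h : k < b ∧ j < a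
    · rw [TtoPP_pos T h.1 h.2]
      have := T_upper hT (j := a - 1 - j) (by omega) k h.1
      have := T_lower T (j := a - 1 - j) (by omega) (b - 1 - k) (by omega)
      omega
    · rw [TtoPP_neg T h]; omega

lemma TtoPP_bij (a b n : ℕ) : Set.BijOn (TtoPP a b) (RectT a b n) (RectPP a b n) := by
  refine ⟨fun T hT => TtoPP_mem hT, fun T hT T' hT' e => ?_, fun π h => ?_⟩
  · refine SemistandardYoungTableau.ext fun i j => ?_
    by_cases hij : i < b ∧ j < a
    · have e' : (TtoPP a b T).entry (b - 1 - i) (a - 1 - j)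
          = (TtoPP a b T').entry (b - 1 - i) (a - 1 - j) := by rw [e]
      rw [TtoPP_pos T (by omega) (by omega), TtoPP_pos T' (by omega) (by omega)] at e'
      rw [show b - 1 - (b - 1 - i) = i by omega, show a - 1 - (a - 1 - j) = j by omega] at e'
      have := T_lower T hij.2 i hij.1
      have := T_lower T' hij.2 i hij.1
      omega
    · rw [T.zeros (by rwa [mem_rect]), T'.zeros (by rwa [mem_rect])]
  · have ranti : ∀ i, Antitone (π.entry i) := fun i => antitone_nat_of_succ_le (π.row_decr i)
    let E : ℕ → ℕ → ℕ := fun i j =>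
      if i < b ∧ j < a then i + π.entry (b - 1 - i) (a - 1 - j) - 1 else 0
    have Epos : ∀ i j, i < b → j < a → E i j = i + π.entry (b - 1 - i) (a - 1 - j) - 1 :=
      fun i j hi hj => if_pos ⟨hi, hj⟩
    let T : SemistandardYoungTableau (rectDiagram a b) :=
      { entry := E
        row_weak' := by
          intro i j1 j2 hj hm
          rw [mem_rect] at hm
          rw [Epos i j1 hm.1 (by omega), Epos i j2 hm.1 hm.2]
          have := ranti (b - 1 - i) (show a - 1 - j2 ≤ a - 1 - j1 by omega)
          omega
        col_strict' := by
          intro i1 i2 j hi hm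
          rw [mem_rect] at hm
          rw [Epos i1 j (by omega) hm.2, Epos i2 j hm.1 hm.2]
          have h1 : π.entry (b - 1 - i1) (a - 1 - j) ≤ π.entry (b - 1 - i2) (a - 1 - j) :=
            PP_anti π (a - 1 - j) (show b - 1 - i2 ≤ b - 1 - i1 by omega)
          have := RectPP_pos h (show b - 1 - i1 < b by omega) (show a - 1 - j < a by omega)
          omega
        zeros' := by
          intro i j hm
          rw [mem_rect] at hm
          exact if_neg hm }
    have TE : ∀ i j, T i j = E i j := fun i j => rfl
    refine ⟨T, ?_, ?_⟩
    · intro i j hm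
      rw [mem_rect] at hm
      rw [TE, Epos i j hm.1 hm.2]
      have := h.2 (b - 1 - i) (a - 1 - j)
      have := RectPP_pos h (show b - 1 - i < b by omega) (show a - 1 - j < a by omega)
      omega
    · refine PP_ext fun k j => ?_
      by_cases hkj : k < b ∧ j < a
      · rw [TtoPP_pos T hkj.1 hkj.2, TE, Epos _ _ (by omega) (by omega)]
        rw [show b - 1 - (b - 1 - k) = k by omega, show a - 1 - (a - 1 - j) = j by omega]
        have := RectPP_pos h hkj.1 hkj.2
        omega
      · rw [TtoPP_neg T hkj, RectPP_zero h k j hkj]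

lemma T_weight {a b n : ℕ} {T : SemistandardYoungTableau (rectDiagram a b)}
    (hT : T ∈ RectT a b n) (x : ℕ → ℝ) :
    ∏ p ∈ (rectDiagram a b).cells, oneExtend (b - 1) x (T p.1 p.2)
      = ∏ l ∈ Finset.range n, x l ^ diagN a b (TtoPP a b T) l := by
  have h := TtoPP_mem hT
  show ∏ p ∈ Finset.range b ×ˢ Finset.range a, oneExtend (b - 1) x (T p.1 p.2) = _
  rw [Finset.prod_product, ← Finset.prod_range_reflect]
  unfold diagN
  simp_rw [← Finset.prod_pow_eq_pow_sum]
  conv_rhs => rw [Finset.prod_comm]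
  refine Finset.prod_congr rfl fun k hk => ?_
  rw [Finset.mem_range] at hk
  rw [← Finset.prod_range_reflect]
  simp_rw [← Finset.prod_const, Finset.prod_filter]
  conv_rhs => rw [Finset.prod_comm]
  refine Finset.prod_congr rfl fun j hj => ?_
  rw [Finset.mem_range] at hj
  have e := TtoPP_pos T hk hj
  have lo := T_lower T (j := a - 1 - j) (by omega) (b - 1 - k) (by omega)
  have up := h.2 k j
  unfold oneExtend
  split_ifs with hc
  · symm
    refine Finset.prod_eq_one fun l _ => if_neg (by omega)
  · rw [Finset.prod_eq_single (T (b - 1 - k) (a - 1 - j) - (b - 1))]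
    · rw [if_pos (by omega)]
    · intro l _ hl
      exact if_neg (by omega)
    · intro hl
      rw [Finset.mem_range] at hl
      omega

/-- Coincidence lemma: for positive integers `a, b` and `n ≥ 1`,
`g_{(a^b)}(x_1,…,x_n) = s_{(a^b)}(1^{b−1}, x_1,…,x_n)`. -/
theorem grothG_rect_eq_schur (a b n : ℕ) (ha : 0 < a) (hb : 0 < b) (hn : 1 ≤ n)
    (x : ℕ → ℝ) :
    grothG (rectDiagram a b) n x
      = schur (rectDiagram a b) (b - 1 + n) (oneExtend (b - 1) x) := by
  obtain ⟨e, he, hw⟩ := all_step a b n n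
  have h1 : grothG (rectDiagram a b) n x = ∑ᶠ G ∈ ArrP a b n,
      ∏ l ∈ Finset.range n, x l ^ (∑ p ∈ Finset.range b, locD G p l) := by
    refine finsum_mem_eq_of_bijOn (toArr a) (toArr_bij a b n) fun π hπ => ?_
    exact Finset.prod_congr rfl fun l _ => by rw [cCol_eq hπ]
  have h2 : schur (rectDiagram a b) (b - 1 + n) (oneExtend (b - 1) x) = ∑ᶠ G ∈ ArrP a b n,
      ∏ l ∈ Finset.range n, x l ^ (colW b G 0 l).toNat := by
    refine finsum_mem_eq_of_bijOn (toArr a ∘ TtoPP a b)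
      ((toArr_bij a b n).comp (TtoPP_bij a b n)) fun T hT => ?_
    rw [T_weight hT]
    refine Finset.prod_congr rfl fun l _ => ?_
    rw [Function.comp, ← diagN_eq (TtoPP_mem hT), Int.toNat_natCast]
  rw [h1, h2]
  refine finsum_mem_eq_of_bijOn e he fun G hG => ?_
  refine Finset.prod_congr rfl fun l hl => ?_
  rw [← (hw G hG).1 l (Finset.mem_range.mp hl), ← Nat.cast_sum, Int.toNat_natCast]
end

section
/- For all positive integers a, b, c and all real numbers x_1,…,x_c: ∑_{π ∈ PP(a,b,c)} ∏_{ℓ=1}^{c} x_ℓ^{c_ℓ(π)} = s_{(a^b)}(1^b, x_1,…,x_c). Consequently, under the uniform probability measure on PP(a,b,c), the probability generating function of the vector (c_1(π),…,c_c(π)) equals the normalized Schur polynomial s_{(a^b)}(1^b, x_1,…,x_c) / s_{(a^b)}(1^{b+c}). -/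
open scoped BigOperators

namespace PgfAux

open Finset

/-- partitions with at most `b` parts, each at most `a`. -/
def Lam (a b : ℕ) : Type :=
  {g : ℕ → ℕ // (∀ i, g (i + 1) ≤ g i) ∧ g 0 ≤ a ∧ ∀ i, b ≤ i → g i = 0}

theorem Lam.anti {a b : ℕ} (l : Lam a b) {i j : ℕ} (h : i ≤ j) : l.1 j ≤ l.1 i :=
  antitone_nat_of_succ_le l.2.1 h

theorem Lam.le {a b : ℕ} (l : Lam a b) (i : ℕ) : l.1 i ≤ a :=
  (l.anti (Nat.zero_le i)).trans l.2.2.1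

instance (a b : ℕ) : Finite (Lam a b) := by
  refine Finite.of_injective
    (fun l : Lam a b => fun i : Fin b => (⟨l.1 i, Nat.lt_succ_of_le (l.le i)⟩ : Fin (a + 1))) ?_
  intro l m h
  apply Subtype.ext
  funext i
  by_cases hi : i < b
  · have := congrFun h ⟨i, hi⟩
    simpa using this
  · rw [l.2.2.2 i (by omega), m.2.2.2 i (by omega)]

noncomputable instance (a b : ℕ) : Fintype (Lam a b) := Fintype.ofFinite _

noncomputable instance (a b : ℕ) : DecidableEq (Lam a b) := Classical.decEq _

/-- the empty partition. -/
def zeroLam (a b : ℕ) : Lam a b := ⟨fun _ => 0, by simp⟩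

def wt (b : ℕ) (l m : ℕ → ℕ) : ℕ := ∑ i ∈ range b, (l i - max (l (i + 1)) (m i))

def condG (k : ℕ) (l m : ℕ → ℕ) : Prop := (∀ i, m i ≤ l i) ∧ ∀ i, k ≤ i → l (i + 1) ≤ m i

def condS (k : ℕ) (l m : ℕ → ℕ) : Prop :=
  (∀ i, i < k → m i = l i) ∧ (∀ i, m i ≤ l i) ∧ ∀ i, l (i + 1) ≤ m i

open Classical in
noncomputable def matG (a b k : ℕ) (x : ℝ) : Matrix (Lam a b) (Lam a b) ℝ :=
  fun l m => if condG k l.1 m.1 then x ^ wt b l.1 m.1 else 0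

open Classical in
noncomputable def matS (a b k : ℕ) : Matrix (Lam a b) (Lam a b) ℝ :=
  fun l m => if condS k l.1 m.1 then 1 else 0

def tog (k : ℕ) (base l n m : ℕ → ℕ) : ℕ → ℕ := fun i =>
  if i < k + 1 then base i else max (l (i + 1)) (n i) + min (l i) (n (i - 1)) - m i

theorem sum_tog (l n m : ℕ → ℕ) (k d : ℕ)
    (h1 : ∀ i, k + 1 ≤ i → m i ≤ max (l (i + 1)) (n i) + min (l i) (n (i - 1))) :
    ∑ i ∈ range d, (tog k l l n m (k + 1 + i) + m (k + 1 + i)) + min (l (k+1+d)) (n (k+d))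
      + l (k + 1)
    = min (l (k + 1)) (n k) + ∑ i ∈ range d, (l (k + 1 + i) + n (k + 1 + i)) + l (k + 1 + d) := by
  induction d with
  | zero => simp
  | succ d ih =>
    rw [sum_range_succ, sum_range_succ]
    have := h1 (k + 1 + d) (by omega)
    have e : tog k l l n m (k + 1 + d) + m (k + 1 + d) =
      max (l (k + 1 + d + 1)) (n (k + 1 + d)) + min (l (k + 1 + d)) (n (k + d)) := by
      have e2 : k + 1 + d - 1 = k + d := by omega
      rw [e2] at this
      simp only [tog]
      rw [if_neg (by omega), e2]
      omega
    rw [e]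
    have e3 : k + (d + 1) = k + 1 + d := by omega
    have e4 : k + 1 + (d + 1) = k + 1 + d + 1 := by omega
    rw [e3, e4]
    omega

theorem tog_wt (b k : ℕ) (l m n : ℕ → ℕ) (hl : ∀ i, l (i + 1) ≤ l i)
    (hlb : ∀ i, b ≤ i → l i = 0)
    (h1 : condG (k + 1) l m) (h2 : condS (k + 1) m n) :
    wt b l m = wt b (tog k l l n m) n := by
  obtain ⟨h11, h12⟩ := h1
  obtain ⟨h21, h22, h23⟩ := h2
  have bd : ∀ i, k + 1 ≤ i → m i ≤ l i ∧ m i ≤ n (i - 1) ∧ l (i + 1) ≤ m i ∧ n i ≤ m i := by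
    intro i hi
    refine ⟨h11 i, ?_, h12 i hi, h22 i⟩
    have := h23 (i - 1)
    rwa [Nat.sub_add_cancel (by omega)] at this
  have tle : ∀ i, i < k + 1 → tog k l l n m i = l i := by
    intro i hi; simp [tog, hi]
  have tge : ∀ i, k + 1 ≤ i → tog k l l n m i =
      max (l (i + 1)) (n i) + min (l i) (n (i - 1)) - m i := by
    intro i hi; simp only [tog]; rw [if_neg (by omega)]
  unfold wt
  by_cases hkb : b ≤ k
  · apply sum_congr rfl
    intro i hi
    have hi := mem_range.1 hi
    rw [tle i (by omega), tle (i+1) (by omega), ← h21 i]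
    omega
  · obtain ⟨d, rfl⟩ : ∃ d, b = k + 1 + d := ⟨b - (k + 1), by omega⟩
    rw [sum_range_add _ (k+1) d, sum_range_add _ (k+1) d, sum_range_succ, sum_range_succ]
    have A : ∑ i ∈ range k, (l i - max (l (i + 1)) (m i)) =
        ∑ i ∈ range k, (tog k l l n m i - max (tog k l l n m (i + 1)) (n i)) := by
      apply sum_congr rfl
      intro i hi
      have hi := mem_range.1 hi
      rw [tle i (by omega), tle (i+1) (by omega), ← h21 i (by omega)]
    have st := sum_tog l n m k d (fun i hi => by have := bd i hi; omega)
    have B1 : ∑ i ∈ range d, (l (k + 1 + i) - max (l (k + 1 + i + 1)) (m (k + 1 + i)))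
        + ∑ i ∈ range d, m (k + 1 + i) = ∑ i ∈ range d, l (k + 1 + i) := by
      rw [← sum_add_distrib]
      apply sum_congr rfl
      intro i _
      have := bd (k + 1 + i) (by omega)
      omega
    have B2 : ∑ i ∈ range d, (tog k l l n m (k + 1 + i)
          - max (tog k l l n m (k + 1 + i + 1)) (n (k + 1 + i)))
        + ∑ i ∈ range d, n (k + 1 + i) = ∑ i ∈ range d, tog k l l n m (k + 1 + i) := by
      rw [← sum_add_distrib]
      apply sum_congr rfl
      intro i _
      have := bd (k + 1 + i) (by omega)
      have h3 := bd (k + 1 + i + 1) (by omega)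
      rw [tge _ (by omega), tge _ (by omega)]
      rw [Nat.add_sub_cancel] at *
      have := hl (k + 1 + i + 1)
      omega
    rw [sum_add_distrib, sum_add_distrib] at st
    rw [hlb (k + 1 + d) le_rfl] at st
    rw [A, tle k (by omega), tge (k + 1) le_rfl, ← h21 k (by omega)]
    have b1 := bd (k + 1) le_rfl
    rw [Nat.add_sub_cancel] at *
    have := h11 k
    have := hl k
    have := h21 k (by omega)
    omega

theorem comm (a b k : ℕ) (x : ℝ) :
    matG a b (k + 1) x * matS a b (k + 1) = matS a b (k + 1) * matG a b k x := by
  classical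
  ext l n
  rw [Matrix.mul_apply, Matrix.mul_apply]
  have e1 : ∀ m : Lam a b, matG a b (k + 1) x l m * matS a b (k + 1) m n =
      if condG (k + 1) l.1 m.1 ∧ condS (k + 1) m.1 n.1 then x ^ wt b l.1 m.1 else 0 := by
    intro m
    simp only [matG, matS]
    split_ifs <;> simp_all
  have e2 : ∀ m : Lam a b, matS a b (k + 1) l m * matG a b k x m n =
      if condS (k + 1) l.1 m.1 ∧ condG k m.1 n.1 then x ^ wt b m.1 n.1 else 0 := by
    intro m
    simp only [matG, matS]
    split_ifs <;> simp_all
  rw [sum_congr rfl (fun m _ => e1 m), sum_congr rfl (fun m _ => e2 m), ← sum_filter, ← sum_filter]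
  have bd1 : ∀ m : Lam a b, condG (k + 1) l.1 m.1 ∧ condS (k + 1) m.1 n.1 → ∀ i, k + 1 ≤ i →
     m.1 i ≤ l.1 i ∧ m.1 i ≤ n.1 (i - 1) ∧ l.1 (i + 1) ≤ m.1 i ∧ n.1 i ≤ m.1 i := by
    rintro m ⟨⟨h11, h12⟩, h21, h22, h23⟩ i hi
    refine ⟨h11 i, ?_, h12 i hi, h22 i⟩
    have := h23 (i - 1)
    rwa [Nat.sub_add_cancel (by omega)] at this
  have bd2 : ∀ m : Lam a b, condS (k + 1) l.1 m.1 ∧ condG k m.1 n.1 → ∀ i, k + 1 ≤ i →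
     m.1 i ≤ l.1 i ∧ m.1 i ≤ n.1 (i - 1) ∧ l.1 (i + 1) ≤ m.1 i ∧ n.1 i ≤ m.1 i := by
    rintro m ⟨⟨h11, h12, h13⟩, h21, h22⟩ i hi
    refine ⟨h12 i, ?_, h13 i, h21 i⟩
    have := h22 (i - 1) (by omega)
    rwa [Nat.sub_add_cancel (by omega)] at this
  have mk1 : ∀ m : Lam a b, (condG (k + 1) l.1 m.1 ∧ condS (k + 1) m.1 n.1) →
      ((∀ i, tog k l.1 l.1 n.1 m.1 (i + 1) ≤ tog k l.1 l.1 n.1 m.1 i) ∧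
        tog k l.1 l.1 n.1 m.1 0 ≤ a ∧ ∀ i, b ≤ i → tog k l.1 l.1 n.1 m.1 i = 0) := by
    intro m hm
    refine ⟨fun i => ?_, ?_, fun i hi => ?_⟩
    · have b1 := bd1 m hm i
      have b2 := bd1 m hm (i + 1)
      have := l.2.1 i
      have := l.2.1 (i + 1)
      have := n.2.1 i
      simp only [tog]
      split_ifs <;> simp only [Nat.add_sub_cancel] at * <;> omega
    · simpa [tog] using l.2.2.1
    · have b1 := bd1 m hm i
      have := l.2.2.2 i hi
      have := l.2.2.2 (i + 1) (by omega)
      have := m.2.2.2 i hi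
      have := n.2.2.2 i hi
      simp only [tog]
      split_ifs <;> omega
  have mk2 : ∀ m : Lam a b, (condS (k + 1) l.1 m.1 ∧ condG k m.1 n.1) →
      ((∀ i, tog k n.1 l.1 n.1 m.1 (i + 1) ≤ tog k n.1 l.1 n.1 m.1 i) ∧
        tog k n.1 l.1 n.1 m.1 0 ≤ a ∧ ∀ i, b ≤ i → tog k n.1 l.1 n.1 m.1 i = 0) := by
    intro m hm
    refine ⟨fun i => ?_, ?_, fun i hi => ?_⟩
    · have b1 := bd2 m hm i
      have b2 := bd2 m hm (i + 1)
      have := l.2.1 i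
      have := l.2.1 (i + 1)
      have := n.2.1 i
      simp only [tog]
      split_ifs <;> simp only [Nat.add_sub_cancel] at * <;> omega
    · simpa [tog] using n.2.2.1
    · have b1 := bd2 m hm i
      have := l.2.2.2 i hi
      have := l.2.2.2 (i + 1) (by omega)
      have := m.2.2.2 i hi
      have := n.2.2.2 i hi
      simp only [tog]
      split_ifs <;> omega
  refine sum_bij' (fun m hm => (⟨tog k l.1 l.1 n.1 m.1, mk1 m (mem_filter.1 hm).2⟩ : Lam a b))
    (fun m hm => (⟨tog k n.1 l.1 n.1 m.1, mk2 m (mem_filter.1 hm).2⟩ : Lam a b)) ?_ ?_ ?_ ?_ ?_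
  · intro m hm
    have hm := (mem_filter.1 hm).2
    refine mem_filter.2 ⟨mem_univ _, ⟨?_, ?_, ?_⟩, ?_, ?_⟩
    · intro i hi; simp [tog, hi]
    · intro i
      have b1 := bd1 m hm i
      simp only [tog]
      split_ifs <;> omega
    · intro i
      have b1 := bd1 m hm i
      have := l.2.1 i
      simp only [tog]
      split_ifs <;> omega
    · intro i
      have b1 := bd1 m hm i
      have := hm.1.1 i
      have := hm.2.2.1 i
      simp only [tog]
      split_ifs <;> omega
    · intro i hi
      have b1 := bd1 m hm (i + 1)
      simp only [tog]
      rw [Nat.add_sub_cancel] at *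
      split_ifs <;> omega
  · intro m hm
    have hm := (mem_filter.1 hm).2
    refine mem_filter.2 ⟨mem_univ _, ⟨?_, ?_⟩, ?_, ?_, ?_⟩
    · intro i
      have b1 := bd2 m hm i
      have := hm.1.2.1 i
      have := hm.2.1 i
      simp only [tog]
      split_ifs <;> omega
    · intro i hi
      have b1 := bd2 m hm i
      have := l.2.1 i
      simp only [tog]
      split_ifs <;> omega
    · intro i hi; simp [tog, hi]
    · intro i
      have b1 := bd2 m hm i
      simp only [tog]
      split_ifs <;> omega
    · intro i
      have b1 := bd2 m hm (i + 1)
      have := n.2.1 i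
      simp only [tog]
      rw [Nat.add_sub_cancel] at *
      split_ifs <;> omega
  · intro m hm
    have hm := (mem_filter.1 hm).2
    apply Subtype.ext
    funext i
    have b1 := bd1 m hm i
    have := hm.2.1 i
    simp only [tog]
    split_ifs <;> omega
  · intro m hm
    have hm := (mem_filter.1 hm).2
    apply Subtype.ext
    funext i
    have b1 := bd2 m hm i
    have := hm.1.1 i
    simp only [tog]
    split_ifs <;> omega
  · intro m hm
    have hm := (mem_filter.1 hm).2
    rw [tog_wt b k l.1 m.1 n.1 l.2.1 l.2.2.2 hm.1 hm.2]

/-- ordered product `M 0 * M 1 * ⋯ * M (n-1)`. -/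
noncomputable def oprod {ι : Type} [Fintype ι] [DecidableEq ι] :
    (ℕ → Matrix ι ι ℝ) → ℕ → Matrix ι ι ℝ
  | _, 0 => 1
  | M, n + 1 => M 0 * oprod (fun t => M (t + 1)) n

theorem oprod_comm {ι : Type} [Fintype ι] [DecidableEq ι] (n : ℕ) (S : Matrix ι ι ℝ) :
    ∀ (M N : ℕ → Matrix ι ι ℝ), (∀ t, M t * S = S * N t) →
      oprod M n * S = S * oprod N n := by
  induction n with
  | zero => intro M N _; simp [oprod]
  | succ n ih =>
    intro M N h
    simp only [oprod]
    rw [Matrix.mul_assoc, ih _ (fun t => N (t + 1)) (fun t => h (t + 1)), ← Matrix.mul_assoc, h 0,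
      Matrix.mul_assoc]

theorem oprod_add {ι : Type} [Fintype ι] [DecidableEq ι] (m n : ℕ) :
    ∀ (M : ℕ → Matrix ι ι ℝ), oprod M (m + n) = oprod M m * oprod (fun t => M (m + t)) n := by
  induction m with
  | zero => intro M; simp [oprod]
  | succ m ih =>
    intro M
    rw [show m + 1 + n = (m + n) + 1 by omega]
    simp only [oprod]
    rw [ih, Matrix.mul_assoc]
    simp only [show ∀ t, m + 1 + t = m + t + 1 by intro t; omega]

theorem oprod_congr {ι : Type} [Fintype ι] [DecidableEq ι] (n : ℕ) :
    ∀ (M N : ℕ → Matrix ι ι ℝ), (∀ t, t < n → M t = N t) → oprod M n = oprod N n := by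
  induction n with
  | zero => intro M N _; simp [oprod]
  | succ n ih =>
    intro M N h
    simp only [oprod]
    rw [h 0 (by omega), ih _ _ (fun t ht => h (t + 1) (by omega))]

theorem oprod_chain {ι : Type} [Fintype ι] [DecidableEq ι] (n : ℕ) (u : ι → ℝ) :
    ∀ (w : ι → ℝ) (M : ℕ → Matrix ι ι ℝ),
      ∑ l, w l * (oprod M n).mulVec u l =
      ∑ f : Fin (n + 1) → ι, w (f 0) * (∏ t : Fin n, M t (f t.castSucc) (f t.succ)) *
        u (f (Fin.last n)) := by
  induction n with
  | zero =>
    intro w M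
    simp only [oprod, Matrix.one_mulVec]
    refine Fintype.sum_equiv (Equiv.funUnique (Fin 1) ι).symm _ _ ?_
    intro l
    simp
  | succ n ih =>
    intro w M
    simp only [oprod]
    have := ih (fun k => ∑ l, w l * M 0 l k) (fun t => M (t + 1))
    calc _ = ∑ k, (∑ l, w l * M 0 l k) * (oprod (fun t => M (t + 1)) n).mulVec u k := by
          simp only [← Matrix.mulVec_mulVec]
          simp only [sum_mul]
          rw [sum_comm]
          apply sum_congr rfl
          intro l _
          conv_lhs => rw [Matrix.mulVec, dotProduct, mul_sum]
          apply sum_congr rfl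
          intro k _
          ring
      _ = _ := by
          rw [this, ← (Fin.consEquiv (fun _ : Fin (n + 2) => ι)).sum_comp, Fintype.sum_prod_type,
            sum_comm]
          apply sum_congr rfl
          intro g _
          rw [sum_mul, sum_mul]
          apply sum_congr rfl
          intro l _
          rw [Fin.prod_univ_succ]
          simp only [Fin.consEquiv, Equiv.coe_fn_mk, Fin.cons_zero, Fin.cons_succ,
            ← Fin.succ_last, Fin.castSucc_zero, ← Fin.succ_castSucc, Fin.val_zero, Fin.val_succ]
          ring

open Classical in
noncomputable def uvec (a b : ℕ) : Lam a b → ℝ := fun l => if ∀ i, l.1 i = 0 then 1 else 0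

theorem matS_u (a b k : ℕ) : (matS a b (k + 1)).mulVec (uvec a b) = uvec a b := by
  classical
  have hu : uvec a b = Pi.single (zeroLam a b) 1 := by
    funext l
    simp only [uvec, Pi.single_apply]
    congr 1
    apply propext
    constructor
    · intro h; exact Subtype.ext (funext h)
    · rintro rfl i; rfl
  conv_lhs => rw [hu]
  rw [Matrix.mulVec_single_one]
  funext l
  simp only [Matrix.col_apply, matS, uvec]
  congr 1
  apply propext
  constructor
  · rintro ⟨h1, _, h3⟩ i
    cases i with
    | zero => exact (h1 0 (by omega)).symm
    | succ i => exact Nat.le_zero.1 (h3 i)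
  · intro h
    simp [condS, zeroLam, h]

theorem main_vec (a b c : ℕ) (x : ℕ → ℝ) (k : ℕ) :
    (oprod (fun t => matG a b k (x t)) c).mulVec (uvec a b) =
    (oprod (fun t => if t < k then matS a b (k - t) else matG a b 0 (x (t - k))) (k + c)).mulVec
      (uvec a b) := by
  induction k with
  | zero => simp
  | succ k ih =>
    conv_lhs => rw [← matS_u a b k]
    rw [Matrix.mulVec_mulVec, oprod_comm c _ _ _ (fun t => comm a b k (x t)),
      ← Matrix.mulVec_mulVec, ih, Matrix.mulVec_mulVec, show k + 1 + c = (k + c) + 1 by omega]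
    simp [oprod]

theorem sum_eq (a b c : ℕ) (x : ℕ → ℝ) (k : ℕ) :
    ∑ f : Fin (c + 1) → Lam a b,
      (∏ t : Fin c, matG a b k (x t) (f t.castSucc) (f t.succ)) * uvec a b (f (Fin.last c)) =
    ∑ f : Fin (k + c + 1) → Lam a b,
      (∏ t : Fin (k + c), (if (t : ℕ) < k then matS a b (k - t) else matG a b 0 (x (t - k)))
        (f t.castSucc) (f t.succ)) * uvec a b (f (Fin.last (k + c))) := by
  have h1 := oprod_chain c (uvec a b) (fun _ => 1) (fun t => matG a b k (x t))
  have h2 := oprod_chain (k + c) (uvec a b) (fun _ => 1)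
    (fun t => if t < k then matS a b (k - t) else matG a b 0 (x (t - k)))
  simp only [one_mul] at h1 h2
  rw [← h1, ← h2, main_vec]

theorem card_lt_iff (a : ℕ) (P : ℕ → Prop) [DecidablePred P] (hP : ∀ i j, i ≤ j → P j → P i)
    (j : ℕ) : j < #{i ∈ range a | P i} ↔ j < a ∧ P j := by
  induction a with
  | zero => simp
  | succ a ih =>
    rw [range_add_one, filter_insert]
    split_ifs with h
    · have : {i ∈ range a | P i} = range a := by
        apply filter_true_of_mem
        intro i hi
        exact hP i a (mem_range.1 hi).le h
      rw [card_insert_of_notMem (by simp), this, card_range]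
      constructor
      · intro hj; exact ⟨hj, hP j a (by omega) h⟩
      · exact fun h => h.1
    · rw [ih]
      constructor
      · rintro ⟨h1, h2⟩; exact ⟨by omega, h2⟩
      · rintro ⟨h1, h2⟩
        refine ⟨?_, h2⟩
        by_contra hc
        have : j = a := by omega
        exact h (this ▸ h2)

theorem eq_of_lt_iff {m n : ℕ} (h : ∀ j, j < m ↔ j < n) : m = n := by
  have h1 := h m
  have h2 := h n
  omega

theorem le_of_lt_imp {m n : ℕ} (h : ∀ j, j < m → j < n) : m ≤ n := by
  by_contra hc
  exact lt_irrefl _ (h n (by omega))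

theorem chain_finsum {ι κ : Type} [Fintype ι] [Fintype κ] (C : κ → ι → Prop) (D : ι → Prop)
    [∀ t f, Decidable (C t f)] [DecidablePred D] (w : κ → ι → ℝ) :
    ∑ f, (∏ t, if C t f then w t f else 0) * (if D f then 1 else 0) =
    ∑ᶠ f ∈ {f | (∀ t, C t f) ∧ D f}, ∏ t, w t f := by
  classical
  have h : ∀ f, (∏ t, if C t f then w t f else 0) * (if D f then (1 : ℝ) else 0) =
      if (∀ t, C t f) ∧ D f then ∏ t, w t f else 0 := by
    intro f
    by_cases hC : ∀ t, C t f
    · simp [hC]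
    · have hn : ¬ ((∀ t, C t f) ∧ D f) := fun h => hC h.1
      rw [if_neg hn]
      push Not at hC
      obtain ⟨t, ht⟩ := hC
      rw [prod_eq_zero (mem_univ t) (by simp [ht]), zero_mul]
  rw [sum_congr rfl (fun f _ => h f), ← sum_filter, ← finsum_mem_coe_finset]
  simp

theorem pp_ext {p q : PlanePartition} (h : ∀ i j, p.entry i j = q.entry i j) : p = q := by
  cases p
  cases q
  congr
  funext i j
  exact h i j

theorem pp_row (p : PlanePartition) (i : ℕ) {j k : ℕ} (h : j ≤ k) : p.entry i k ≤ p.entry i j :=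
  antitone_nat_of_succ_le (f := fun j => p.entry i j) (p.row_decr i) h

theorem pp_col (p : PlanePartition) (j : ℕ) {i k : ℕ} (h : i ≤ k) : p.entry k j ≤ p.entry i j :=
  antitone_nat_of_succ_le (f := fun i => p.entry i j) (fun i => p.col_decr i j) h

def val (a b : ℕ) (p : PlanePartition) (t i : ℕ) : ℕ :=
  if i < b then #{j ∈ range a | t < p.entry i j} else 0

theorem val_lt {a b c : ℕ} {p : PlanePartition} (hp : p ∈ PP a b c) (t i j : ℕ) :
    j < val a b p t i ↔ t < p.entry i j := by
  obtain ⟨h1, h2, h3⟩ := hp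
  unfold val
  split_ifs with hi
  · rw [card_lt_iff a (fun j => t < p.entry i j)
      (fun j k hjk hk => lt_of_lt_of_le hk (pp_row p i hjk))]
    constructor
    · exact fun h => h.2
    · intro h
      refine ⟨?_, h⟩
      by_contra hc
      rw [h1 i j (by omega)] at h
      omega
  · rw [h2 i j (by omega)]
    omega

def eL (a b c : ℕ) (p : PlanePartition) : Fin (c + 1) → Lam a b := fun t =>
  ⟨val a b p t, by
    refine ⟨fun i => ?_, ?_, fun i hi => ?_⟩
    · unfold val
      split_ifs
      · apply card_le_card
        intro j
        simp only [mem_filter]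
        rintro ⟨h1, h2⟩
        exact ⟨h1, lt_of_lt_of_le h2 (p.col_decr i j)⟩
      · omega
      · omega
      · omega
    · unfold val
      split_ifs
      · exact (card_filter_le _ _).trans (by simp)
      · omega
    · unfold val
      rw [if_neg (by omega)]⟩

/-- extension by zero of a chain of partitions. -/
def ext {a b n : ℕ} (f : Fin (n + 1) → Lam a b) (t i : ℕ) : ℕ :=
  if h : t < n + 1 then (f ⟨t, h⟩).1 i else 0

theorem ext_fin {a b n : ℕ} (f : Fin (n + 1) → Lam a b) (t : Fin (n + 1)) :
    ext f t = (f t).1 := by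
  funext i
  simp only [ext]
  rw [dif_pos t.2]

theorem ext_castSucc {a b n : ℕ} (f : Fin (n + 1) → Lam a b) (t : Fin n) :
    (f t.castSucc).1 = ext f t := by
  rw [← ext_fin]; rfl

theorem ext_succ {a b n : ℕ} (f : Fin (n + 1) → Lam a b) (t : Fin n) :
    (f t.succ).1 = ext f (t + 1) := by
  rw [← ext_fin]; rfl

theorem ext_anti_row {a b n : ℕ} (f : Fin (n + 1) → Lam a b) (t : ℕ) {i j : ℕ} (h : i ≤ j) :
    ext f t j ≤ ext f t i := by
  unfold ext
  split_ifs
  · exact Lam.anti _ h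
  · exact le_rfl

theorem ext_le {a b n : ℕ} (f : Fin (n + 1) → Lam a b) (t i : ℕ) : ext f t i ≤ a := by
  unfold ext
  split_ifs
  · exact Lam.le _ _
  · omega

theorem ext_zero {a b n : ℕ} (f : Fin (n + 1) → Lam a b) (t i : ℕ) (h : b ≤ i) :
    ext f t i = 0 := by
  unfold ext
  split_ifs with h1
  · exact (f ⟨t, h1⟩).2.2.2 i h
  · rfl

theorem ext_anti {a b n : ℕ} (f : Fin (n + 1) → Lam a b)
    (h : ∀ t : Fin n, ∀ i, (f t.succ).1 i ≤ (f t.castSucc).1 i) (i : ℕ) {s t : ℕ} (hst : s ≤ t) :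
    ext f t i ≤ ext f s i := by
  refine antitone_nat_of_succ_le (f := fun t => ext f t i) (fun t => ?_) hst
  by_cases ht : t < n
  · have := h ⟨t, ht⟩ i
    rw [ext_succ, ext_castSucc] at this
    exact this
  · simp [ext, show ¬ (t < n) from ht]

theorem ext_last {a b n : ℕ} (f : Fin (n + 1) → Lam a b)
    (h : ∀ i, (f (Fin.last n)).1 i = 0) (t i : ℕ) (hst : n ≤ t) :
    ext f t i = 0 := by
  by_cases ht : t < n + 1
  · have : t = n := by omega
    subst this
    have := h i
    rw [← ext_fin] at this
    simpa using this
  · simp [ext, ht]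

theorem ext_inj {a b n : ℕ} {f g : Fin (n + 1) → Lam a b} (h : ∀ t i, t ≤ n → ext f t i = ext g t i) :
    f = g := by
  funext t
  apply Subtype.ext
  rw [← ext_fin, ← ext_fin]
  funext i
  exact h t i (by omega)

def invL {a b c : ℕ} (f : Fin (c + 1) → Lam a b) : PlanePartition where
  entry i j := #{t ∈ range c | j < ext f t i}
  row_decr i j := by
    apply card_le_card
    intro t
    simp only [mem_filter]
    rintro ⟨h1, h2⟩
    exact ⟨h1, by omega⟩
  col_decr i j := by
    apply card_le_card
    intro t
    simp only [mem_filter]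
    rintro ⟨h1, h2⟩
    exact ⟨h1, lt_of_lt_of_le h2 (ext_anti_row f t (by omega))⟩
  finite_support := by
    refine ((range b ×ˢ range a).finite_toSet).subset ?_
    rintro ⟨i, j⟩ h
    simp only [Set.mem_ofPred_eq, ne_eq, card_eq_zero] at h
    obtain ⟨t, ht⟩ := Finset.nonempty_iff_ne_empty.2 h
    have ht := (mem_filter.1 ht).2
    have h1 := ext_le f t i
    simp only [coe_product, Set.mem_prod, mem_coe, mem_range]
    refine ⟨?_, by omega⟩
    by_contra hc
    rw [ext_zero f t i (by omega)] at ht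
    omega

def VL (a b c k : ℕ) : Set (Fin (c + 1) → Lam a b) :=
  {f | (∀ t : Fin c, condG k (f t.castSucc).1 (f t.succ).1) ∧ ∀ i, (f (Fin.last c)).1 i = 0}

theorem invL_mem {a b c : ℕ} (f : Fin (c + 1) → Lam a b) : invL f ∈ PP a b c := by
  refine ⟨?_, ?_, ?_⟩
  · intro i j h
    simp only [invL, card_eq_zero]
    apply filter_false_of_mem
    intro t _
    have := ext_le f t i
    omega
  · intro i j h
    simp only [invL, card_eq_zero]
    apply filter_false_of_mem
    intro t _
    have := ext_zero f t i h
    omega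
  · intro i j
    exact (card_filter_le _ _).trans (card_range c).le

theorem bijL (a B c : ℕ) : Set.BijOn (eL a (B + 1) c) (PP a (B + 1) c) (VL a (B + 1) c B) := by
  have extval : ∀ p, ∀ t i, t ≤ c → ext (eL a (B + 1) c p) t i = val a (B + 1) p t i := by
    intro p t i h
    simp [ext, eL, show t < c + 1 by omega]
  refine Set.InvOn.bijOn (f' := invL) ⟨?_, ?_⟩ ?_ ?_
  · intro p hp
    apply pp_ext
    intro i j
    apply eq_of_lt_iff
    intro t
    simp only [invL]
    rw [card_lt_iff]
    · constructor
      · rintro ⟨h1, h2⟩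
        rw [extval p t i (by omega), val_lt hp] at h2
        exact h2
      · intro h
        have h3 : p.entry i j ≤ c := hp.2.2 i j
        refine ⟨by omega, ?_⟩
        rw [extval p t i (by omega), val_lt hp]
        exact h
    · intro s t hst h
      refine lt_of_lt_of_le h (ext_anti _ ?_ i hst)
      intro t i
      apply le_of_lt_imp
      intro j
      simp only [eL]
      rw [val_lt hp, val_lt hp]
      simp
      omega
  · rintro f ⟨hf1, hf2⟩
    apply ext_inj
    intro t i ht
    rw [extval _ t i ht]
    apply eq_of_lt_iff
    intro j
    rw [val_lt (invL_mem f)]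
    simp only [invL]
    rw [card_lt_iff]
    · constructor
      · exact fun h => h.2
      · intro h
        refine ⟨?_, h⟩
        by_contra hc
        rw [ext_last f hf2 t i (by omega)] at h
        omega
    · intro s t hst h
      exact lt_of_lt_of_le h (ext_anti f (fun t => (hf1 t).1) i hst)
  · intro p hp
    refine ⟨fun t => ⟨fun i => ?_, fun i hi => ?_⟩, fun i => ?_⟩
    · apply le_of_lt_imp
      intro j
      simp only [eL]
      rw [val_lt hp, val_lt hp]
      simp
      omega
    · simp only [eL, val]
      rw [if_neg (by omega)]
      omega
    · by_contra hc
      have h0 : 0 < (eL a (B + 1) c p (Fin.last c)).1 i := by omega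
      simp only [eL] at h0
      rw [val_lt hp] at h0
      have h3 : p.entry i 0 ≤ c := hp.2.2 i 0
      simp at h0
      omega
  · intro f _
    exact invL_mem f

theorem cCol_eq (a b c : ℕ) (p : PlanePartition) (hp : p ∈ PP a b c) (t : ℕ) :
    p.cCol (t + 1) = wt b (val a b p t) (val a b p (t + 1)) := by
  have hset : {j | ∃ i, p.entry i j = t + 1} =
      ((range b).biUnion (fun i => Ico (max (val a b p t (i + 1)) (val a b p (t + 1) i))
        (val a b p t i)) : Finset ℕ) := by
    ext j
    simp only [Set.mem_ofPred_eq, coe_biUnion, mem_coe, Set.mem_iUnion, mem_range, coe_Ico,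
      Set.mem_Ico, max_le_iff, exists_prop]
    constructor
    · rintro ⟨i, hi⟩
      have hfin : ∀ k, p.entry k j = t + 1 → k < b := by
        intro k hk
        by_contra hc
        have : p.entry k j = 0 := hp.2.1 k j (by omega)
        omega
      -- take the last such row
      let m := Nat.findGreatest (fun k => p.entry k j = t + 1) b
      have hm : p.entry m j = t + 1 :=
        Nat.findGreatest_spec (P := fun k => p.entry k j = t + 1) (hfin i hi).le hi
      have hm1 : p.entry (m + 1) j ≠ t + 1 := by
        intro h
        have := Nat.le_findGreatest (P := fun k => p.entry k j = t + 1) (hfin _ h).le h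
        change m + 1 ≤ m at this
        omega
      have hd := p.col_decr m j
      refine ⟨m, hfin m hm, ⟨?_, ?_⟩, ?_⟩
      · rw [← not_lt, val_lt hp]; omega
      · rw [← not_lt, val_lt hp]; omega
      · rw [val_lt hp]; omega
    · rintro ⟨i, hi, ⟨h1, h2⟩, h3⟩
      rw [← not_lt, val_lt hp] at h1 h2
      rw [val_lt hp] at h3
      exact ⟨i, by omega⟩
  unfold PlanePartition.cCol
  rw [hset, Set.ncard_coe_finset, card_biUnion]
  · simp [wt]
  · have key : ∀ i k, i < k → Disjoint
        (Ico (max (val a b p t (i + 1)) (val a b p (t + 1) i)) (val a b p t i))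
        (Ico (max (val a b p t (k + 1)) (val a b p (t + 1) k)) (val a b p t k)) := by
      intro i k hik
      rw [Finset.disjoint_left]
      intro j h1 h2
      simp only [mem_Ico, max_le_iff] at h1 h2
      have h3 := (val_lt hp t k j).1 h2.2
      have h4 := h1.1.1
      rw [← not_lt, val_lt hp] at h4
      have := pp_col p j (show i + 1 ≤ k from hik)
      omega
    intro i _ k _ hik
    rcases lt_or_gt_of_ne hik with h | h
    · exact key i k h
    · exact (key k i h).symm

theorem lhs_eq (a B c : ℕ) (x : ℕ → ℝ) :
    ∑ᶠ p ∈ PP a (B + 1) c, ∏ t ∈ range c, x t ^ p.cCol (t + 1) =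
    ∑ f : Fin (c + 1) → Lam a (B + 1),
      (∏ t : Fin c, matG a (B + 1) B (x t) (f t.castSucc) (f t.succ)) *
        uvec a (B + 1) (f (Fin.last c)) := by
  classical
  have := chain_finsum (fun (t : Fin c) (f : Fin (c + 1) → Lam a (B + 1)) =>
      condG B (f t.castSucc).1 (f t.succ).1) (fun f => ∀ i, (f (Fin.last c)).1 i = 0)
      (fun t f => x t ^ wt (B + 1) (f t.castSucc).1 (f t.succ).1)
  simp only [matG, uvec]
  refine Eq.trans ?_ (Eq.trans this.symm ?_)
  · refine finsum_mem_eq_of_bijOn (eL a (B + 1) c) (bijL a B c) ?_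
    intro p hp
    rw [Finset.prod_range]
    apply prod_congr rfl
    intro t _
    rw [cCol_eq a (B + 1) c p hp]
    simp [eL]
  · apply sum_congr rfl
    intro f _
    congr

abbrev Tab (a B : ℕ) := SemistandardYoungTableau (rectDiagram a (B + 1))

theorem mem_rect {a b i j : ℕ} : (i, j) ∈ rectDiagram a b ↔ i < b ∧ j < a := by
  rw [← YoungDiagram.mem_cells]
  simp [rectDiagram]

theorem tab_ge {a B : ℕ} (T : Tab a B) (r j : ℕ) (hr : r < B + 1) (hj : j < a) : r ≤ T r j := by
  induction r with
  | zero => omega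
  | succ r ih =>
    have h1 := ih (by omega)
    have h2 := T.col_strict (show r < r + 1 by omega) (mem_rect.2 ⟨hr, hj⟩)
    omega

def valT {a B : ℕ} (T : Tab a B) (t i : ℕ) : ℕ :=
  if i < B + 1 then #{j ∈ range a | max t (B - i) < T (B - i) (a - 1 - j)} else 0

theorem valT_lt {a B : ℕ} (T : Tab a B) (t i j : ℕ) :
    j < valT T t i ↔ i < B + 1 ∧ j < a ∧ max t (B - i) < T (B - i) (a - 1 - j) := by
  unfold valT
  by_cases hi : i < B + 1
  · rw [if_pos hi]
    by_cases ha : 0 < a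
    · rw [card_lt_iff a (fun j => max t (B - i) < T (B - i) (a - 1 - j))]
      · simp [hi]
      · intro s t hst h
        exact lt_of_lt_of_le h (T.row_weak_of_le (by omega) (mem_rect.2 ⟨by omega, by omega⟩))
    · have : a = 0 := by omega
      subst this
      simp
  · rw [if_neg hi]
    omega

theorem valT_step {a B : ℕ} (T : Tab a B) (t i : ℕ) : valT T t (i + 1) ≤ valT T (t + 1) i := by
  apply le_of_lt_imp
  intro j
  rw [valT_lt, valT_lt]
  rintro ⟨h1, h2, h3⟩
  have := T.col_strict (show B - (i + 1) < B - i by omega)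
    (mem_rect.2 ⟨by omega, show a - 1 - j < a by omega⟩)
  refine ⟨by omega, h2, by omega⟩

theorem valT_mono {a B : ℕ} (T : Tab a B) (t i : ℕ) : valT T (t + 1) i ≤ valT T t i := by
  apply le_of_lt_imp
  intro j
  rw [valT_lt, valT_lt]
  rintro ⟨h1, h2, h3⟩
  refine ⟨by omega, h2, by omega⟩

def eR (a B c : ℕ) (T : Tab a B) : Fin (B + c + 1) → Lam a (B + 1) := fun t =>
  ⟨valT T t, fun i => (valT_step T t i).trans (valT_mono T t i), by
    unfold valT
    rw [if_pos (by omega)]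
    exact (card_filter_le _ _).trans (card_range a).le, by
    intro i hi
    unfold valT
    rw [if_neg (by omega)]⟩

def VR (a B c : ℕ) : Set (Fin (B + c + 1) → Lam a (B + 1)) :=
  {f | (∀ t : Fin (B + c), condS (B - t) (f t.castSucc).1 (f t.succ).1) ∧
    ∀ i, (f (Fin.last (B + c))).1 i = 0}

def TS (a B c : ℕ) : Set (Tab a B) :=
  {T | ∀ i j, (i, j) ∈ rectDiagram a (B + 1) → T i j < B + 1 + c}

theorem ext_eR {a B c : ℕ} (T : Tab a B) (t i : ℕ) (ht : t ≤ B + c) :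
    ext (eR a B c T) t i = valT T t i := by
  simp only [ext]
  rw [dif_pos (by omega)]
  rfl

theorem tab_lt {a B c : ℕ} {T : Tab a B} (hT : T ∈ TS a B c) {r j : ℕ} (hr : r < B + 1)
    (hj : j < a) (m : ℕ) :
    m < T r j ↔ m < r ∨ a - 1 - j < ext (eR a B c T) m (B - r) := by
  have h1 := tab_ge T r j hr hj
  have h2 : T r j < B + 1 + c := hT r j (mem_rect.2 ⟨hr, hj⟩)
  by_cases hm : m ≤ B + c
  · rw [ext_eR T m _ hm, valT_lt, show B - (B - r) = r by omega,
      show a - 1 - (a - 1 - j) = j by omega]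
    omega
  · have : ext (eR a B c T) m (B - r) = 0 := by
      simp only [ext]
      rw [dif_neg (by omega)]
    omega

theorem freeze {a B c : ℕ} {f : Fin (B + c + 1) → Lam a (B + 1)} (hf : f ∈ VR a B c)
    (t i d : ℕ) (h : t + d ≤ B - i) : ext f (t + d) i = ext f t i := by
  induction d with
  | zero => rfl
  | succ d ih =>
    have h1 := (hf.1 ⟨t + d, by omega⟩).1 i (by simp; omega)
    rw [ext_castSucc, ext_succ] at h1
    rw [← ih (by omega)]
    exact h1

def enR {a B c : ℕ} (f : Fin (B + c + 1) → Lam a (B + 1)) (r j : ℕ) : ℕ :=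
  if r < B + 1 ∧ j < a then #{t ∈ range (B + 1 + c) | t < r ∨ a - 1 - j < ext f t (B - r)} else 0

theorem enR_lt {a B c : ℕ} {f : Fin (B + c + 1) → Lam a (B + 1)} (hf : f ∈ VR a B c)
    {r j : ℕ} (hr : r < B + 1) (hj : j < a) (m : ℕ) :
    m < enR f r j ↔ m < r ∨ a - 1 - j < ext f m (B - r) := by
  unfold enR
  rw [if_pos ⟨hr, hj⟩, card_lt_iff]
  · constructor
    · exact fun h => h.2
    · intro h
      refine ⟨?_, h⟩
      by_contra hc
      rw [ext_last f hf.2 m _ (by omega)] at h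
      omega
  · intro s t hst h
    have := ext_anti f (fun t => (hf.1 t).2.1) (B - r) hst
    omega

theorem enR_col {a B c : ℕ} {f : Fin (B + c + 1) → Lam a (B + 1)} (hf : f ∈ VR a B c)
    {r j : ℕ} (hr : r + 1 < B + 1) (hj : j < a) : enR f r j < enR f (r + 1) j := by
  rw [enR_lt hf hr hj]
  by_cases h0 : enR f r j < r + 1
  · exact Or.inl h0
  · right
    obtain ⟨m, hm⟩ : ∃ m, enR f r j = m + 1 := ⟨enR f r j - 1, by omega⟩
    have h1 := (enR_lt hf (show r < B + 1 by omega) hj m).1 (by omega)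
    have h2 : a - 1 - j < ext f m (B - r) := by omega
    rw [hm]
    refine lt_of_lt_of_le h2 ?_
    have hmB : m < B + c := by
      by_contra hc
      rw [ext_last f hf.2 m _ (by omega)] at h2
      omega
    have h3 := (hf.1 ⟨m, hmB⟩).2.2 (B - (r + 1))
    rw [ext_castSucc, ext_succ, show B - (r + 1) + 1 = B - r by omega] at h3
    exact h3

def tabOf {a B c : ℕ} {f : Fin (B + c + 1) → Lam a (B + 1)} (hf : f ∈ VR a B c) : Tab a B where
  entry := enR f
  row_weak' := by
    intro i j1 j2 h hm
    obtain ⟨hi, hj⟩ := mem_rect.1 hm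
    apply le_of_lt_imp
    intro m
    rw [enR_lt hf hi (by omega), enR_lt hf hi hj]
    omega
  col_strict' := by
    intro i1 i2 j h hm
    obtain ⟨hi, hj⟩ := mem_rect.1 hm
    clear hm
    induction i2, h using Nat.le_induction with
    | base => exact enR_col hf hi hj
    | succ n hn ih => exact (ih (by omega)).trans (enR_col hf hi hj)
  zeros' := by
    intro i j h
    rw [mem_rect] at h
    unfold enR
    rw [if_neg h]

theorem tabOf_apply {a B c : ℕ} {f : Fin (B + c + 1) → Lam a (B + 1)} (hf : f ∈ VR a B c)
    (i j : ℕ) : tabOf hf i j = enR f i j := rfl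

theorem bijR (a B c : ℕ) : Set.BijOn (eR a B c) (TS a B c) (VR a B c) := by
  refine ⟨?_, ?_, ?_⟩
  · intro T hT
    refine ⟨fun t => ⟨fun i hi => ?_, fun i => valT_mono T t i, fun i => valT_step T t i⟩,
      fun i => ?_⟩
    · apply eq_of_lt_iff
      intro j
      change j < valT T (t + 1) i ↔ j < valT T t i
      rw [valT_lt, valT_lt, show max ((t : ℕ) + 1) (B - i) = max (t : ℕ) (B - i) by omega]
    · change valT T (B + c) i = 0
      by_contra hc
      have h := (valT_lt T (B + c) i 0).1 (by omega)
      have := hT (B - i) (a - 1 - 0) (mem_rect.2 ⟨by omega, by omega⟩)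
      omega
  · intro T hT U hU h
    apply SemistandardYoungTableau.ext
    intro i j
    by_cases hij : (i, j) ∈ rectDiagram a (B + 1)
    · obtain ⟨hi, hj⟩ := mem_rect.1 hij
      apply eq_of_lt_iff
      intro m
      rw [tab_lt hT hi hj, tab_lt hU hi hj, h]
    · rw [T.zeros hij, U.zeros hij]
  · intro f hf
    refine ⟨tabOf hf, ?_, ?_⟩
    · intro i j hij
      obtain ⟨hi, hj⟩ := mem_rect.1 hij
      rw [tabOf_apply]
      by_contra hc
      have h := (enR_lt hf hi hj (B + c)).1 (by omega)
      rw [ext_last f hf.2 (B + c) _ le_rfl] at h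
      omega
    · apply ext_inj
      intro t i ht
      rw [ext_eR _ _ _ ht]
      apply eq_of_lt_iff
      intro j
      rw [valT_lt]
      have key : ∀ _ : i < B + 1, ∀ _ : j < a,
          (max t (B - i) < tabOf hf (B - i) (a - 1 - j) ↔ j < ext f t i) := by
        intro hi hj
        rw [tabOf_apply, enR_lt hf (by omega) (by omega), show B - (B - i) = i by omega,
          show a - 1 - (a - 1 - j) = j by omega]
        have : ext f (max t (B - i)) i = ext f t i := by
          by_cases h : t ≤ B - i
          · have := freeze hf t i (B - i - t) (by omega)
            rw [max_eq_right h, ← this]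
            congr 1
            omega
          · rw [max_eq_left (by omega)]
        rw [this]
        omega
      constructor
      · rintro ⟨h1, h2, h3⟩
        exact (key h1 h2).1 h3
      · intro h
        have h2 := ext_le f t i
        have h1 : i < B + 1 := by
          by_contra hc
          rw [ext_zero f t i (by omega)] at h
          omega
        exact ⟨h1, by omega, (key h1 (by omega)).2 h⟩

theorem row_card {a B : ℕ} (T : Tab a B) (l i : ℕ) (hi : i < B + 1) :
    #{j ∈ range a | T (B - i) (a - 1 - j) = B + 1 + l} =
      valT T (B + l) i - max (valT T (B + l) (i + 1)) (valT T (B + l + 1) i) := by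
  rw [max_eq_right (valT_step T (B + l) i), ← Nat.card_Ico (valT T (B + l + 1) i)]
  refine congrArg Finset.card (Finset.ext fun j => ?_)
  rw [mem_filter, mem_Ico, ← not_lt, valT_lt, valT_lt, mem_range]
  omega

theorem weightR (a B c : ℕ) (x : ℕ → ℝ) (T : Tab a B) (hT : T ∈ TS a B c) :
    ∏ p ∈ (rectDiagram a (B + 1)).cells, oneExtend (B + 1) x (T p.1 p.2) =
    ∏ t : Fin (B + c), if (t : ℕ) < B then 1 else
      x (t - B) ^ wt (B + 1) ((eR a B c T) t.castSucc).1 ((eR a B c T) t.succ).1 := by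
  have h1 : ∏ p ∈ (rectDiagram a (B + 1)).cells, oneExtend (B + 1) x (T p.1 p.2) =
      ∏ r ∈ range (B + 1), ∏ j ∈ range a, oneExtend (B + 1) x (T r j) := by
    change ∏ p ∈ range (B + 1) ×ˢ range a, _ = _
    rw [prod_product]
  have h2 : ∀ r ∈ range (B + 1), ∏ j ∈ range a, oneExtend (B + 1) x (T (B + 1 - 1 - r) j) =
      ∏ l ∈ range c, x l ^ (valT T (B + l) r -
        max (valT T (B + l) (r + 1)) (valT T (B + l + 1) r)) := by
    intro r hr
    have hr := mem_range.1 hr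
    rw [Nat.add_sub_cancel, ← prod_range_reflect]
    have h3 : ∀ j ∈ range a, oneExtend (B + 1) x (T (B - r) (a - 1 - j)) =
        ∏ l ∈ range c, if T (B - r) (a - 1 - j) = B + 1 + l then x l else 1 := by
      intro j hj
      have hj := mem_range.1 hj
      have h4 : T (B - r) (a - 1 - j) < B + 1 + c :=
        hT _ _ (mem_rect.2 ⟨by omega, by omega⟩)
      generalize T (B - r) (a - 1 - j) = v at h4
      unfold oneExtend
      split_ifs with hv
      · symm
        apply prod_eq_one
        intro l _
        rw [if_neg (by omega)]
      · rw [prod_eq_single (v - (B + 1))]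
        · rw [if_pos (by omega)]
        · intro l _ hl
          rw [if_neg (by omega)]
        · intro h
          exact absurd (mem_range.2 (by omega)) h
    rw [prod_congr rfl h3, prod_comm]
    apply prod_congr rfl
    intro l _
    rw [← row_card T l r hr, prod_ite, prod_const, prod_const_one, mul_one]
  rw [h1, ← prod_range_reflect, prod_congr rfl h2, prod_comm]
  have h5 : ∀ t : Fin (B + c), (if (t : ℕ) < B then 1 else
      x (t - B) ^ wt (B + 1) ((eR a B c T) t.castSucc).1 ((eR a B c T) t.succ).1) =
      (fun t : ℕ => if t < B then 1 else x (t - B) ^ wt (B + 1) (valT T t) (valT T (t + 1))) t := by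
    intro t
    rfl
  rw [prod_congr rfl (fun t _ => h5 t), Fin.prod_univ_eq_prod_range
    (fun t : ℕ => if t < B then 1 else x (t - B) ^ wt (B + 1) (valT T t) (valT T (t + 1))),
    prod_range_add]
  rw [prod_eq_one (s := range B), one_mul]
  · apply prod_congr rfl
    intro l _
    rw [if_neg (by omega), Nat.add_sub_cancel_left, prod_pow_eq_pow_sum]
    rfl
  · intro t ht
    rw [if_pos (mem_range.1 ht)]

theorem rhs_eq (a B c : ℕ) (x : ℕ → ℝ) :
    schur (rectDiagram a (B + 1)) (B + 1 + c) (oneExtend (B + 1) x) =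
    ∑ f : Fin (B + c + 1) → Lam a (B + 1),
      (∏ t : Fin (B + c), (if (t : ℕ) < B then matS a (B + 1) (B - t)
        else matG a (B + 1) 0 (x (t - B))) (f t.castSucc) (f t.succ)) *
        uvec a (B + 1) (f (Fin.last (B + c))) := by
  classical
  have := chain_finsum (fun (t : Fin (B + c)) (f : Fin (B + c + 1) → Lam a (B + 1)) =>
      condS (B - t) (f t.castSucc).1 (f t.succ).1) (fun f => ∀ i, (f (Fin.last (B + c))).1 i = 0)
      (fun t f => if (t : ℕ) < B then 1 else
        x (t - B) ^ wt (B + 1) (f t.castSucc).1 (f t.succ).1)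
  refine Eq.trans ?_ (Eq.trans this.symm ?_)
  · exact finsum_mem_eq_of_bijOn (eR a B c) (bijR a B c) (fun T hT => weightR a B c x T hT)
  · apply sum_congr rfl
    intro f _
    congr 1
    · apply prod_congr rfl
      intro t _
      by_cases ht : (t : ℕ) < B
      · simp only [ht, if_true, matS]
      · have e : B - (t : ℕ) = 0 := by omega
        simp only [ht, if_false, matG, e]
        have : condS 0 (f t.castSucc).1 (f t.succ).1 ↔ condG 0 (f t.castSucc).1 (f t.succ).1 := by
          simp [condS, condG]
        simp only [this]

theorem part1 (a B c : ℕ) (x : ℕ → ℝ) :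
    ∑ᶠ p ∈ PP a (B + 1) c, ∏ t ∈ range c, x t ^ p.cCol (t + 1) =
    schur (rectDiagram a (B + 1)) (B + 1 + c) (oneExtend (B + 1) x) := by
  rw [lhs_eq, rhs_eq, sum_eq]

theorem PP_finite (a B c : ℕ) : (PP a (B + 1) c).Finite := by
  have := (bijL a B c).image_eq
  exact Set.Finite.of_finite_image (this ▸ Set.toFinite _) (bijL a B c).injOn

theorem ncard_eq (a B c : ℕ) : ((PP a (B + 1) c).ncard : ℝ) =
    schur (rectDiagram a (B + 1)) (B + 1 + c) (fun _ => 1) := by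
  have h := part1 a B c (fun _ => 1)
  have h1 : oneExtend (B + 1) (fun _ => (1 : ℝ)) = fun _ => 1 := by
    funext i
    simp [oneExtend]
  rw [h1] at h
  rw [← h]
  simp only [one_pow, prod_const_one]
  rw [finsum_mem_eq_finite_toFinset_sum _ (PP_finite a B c),
    Set.ncard_eq_toFinset_card _ (PP_finite a B c)]
  simp

end PgfAux

/-- `∑_{π ∈ PP(a,b,c)} ∏_{ℓ=1}^{c} x_ℓ^{c_ℓ(π)} = s_{(a^b)}(1^b, x_1,…,x_c)`;
consequently the probability generating function of `(c_1(π),…,c_c(π))` under the uniform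
measure on `PP(a,b,c)` is the normalized Schur polynomial. -/
theorem pgf_corners_eq_normalized_schur (a b c : ℕ) (ha : 0 < a) (hb : 0 < b) (hc : 0 < c)
    (x : ℕ → ℝ) :
    (∑ᶠ π ∈ PP a b c, ∏ ℓ ∈ Finset.range c, x ℓ ^ π.cCol (ℓ + 1)
        = schur (rectDiagram a b) (b + c) (oneExtend b x)) ∧
    ((PP a b c).ncard : ℝ)⁻¹ *
        ∑ᶠ π ∈ PP a b c, ∏ ℓ ∈ Finset.range c, x ℓ ^ π.cCol (ℓ + 1)
      = schur (rectDiagram a b) (b + c) (oneExtend b x)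
        / schur (rectDiagram a b) (b + c) (fun _ => 1) := by
  obtain ⟨B, rfl⟩ : ∃ B, b = B + 1 := ⟨b - 1, by omega⟩
  have h1 := PgfAux.part1 a B c x
  refine ⟨h1, ?_⟩
  rw [h1, PgfAux.ncard_eq, div_eq_inv_mul]
end
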